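/- Every uplifting cardinal κ is a limit of Σ₃-reflecting cardinals: for every ordinal θ < κ there is a Σ₃-reflecting cardinal β with θ < β < κ. -/

import Mathlib

open FirstOrder Language

universe u

namespace Paper

/-- The language of set theory: a single binary relation symbol (membership).
We reuse `FirstOrder.Language.graph`, whose sole symbol is a binary relation. -/
abbrev LSet : FirstOrder.Language := FirstOrder.Language.graph

/-- The rank-initial segment `V_α` of the cumulative hierarchy, realized as the
collection of ZF sets of rank less than `α`. -/
abbrev Vt (α : Ordinal) : Type 1 := {x : ZFSet // x.rank < α}

/-- `V_α` as a structure in the language of set theory, with the membership relation. -/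
instance VtStructure (α : Ordinal) : LSet.Structure (Vt α) where
  funMap := fun f _ => f.elim
  RelMap := fun r x => match r with | .adj => (x 0).1 ∈ (x 1).1

/-- The universe of sets as a structure in the language of set theory. -/
instance ZFSetStructure : LSet.Structure ZFSet where
  funMap := fun f _ => f.elim
  RelMap := fun r x => match r with | .adj => x 0 ∈ x 1

/-- `V_α ≺ V_β`: the inclusion of `V_α` into `V_β` is an elementary embedding. -/
def VElem (α β : Ordinal) : Prop :=
  ∃ e : Vt α ↪ₑ[LSet] Vt β, ∀ x : Vt α, (e x : ZFSet) = x

/-- An ordinal which is a cardinal. -/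
def IsCardOrd (γ : Ordinal) : Prop := γ.card.ord = γ

/-- An ordinal which is a regular cardinal. -/
def IsRegularOrd (γ : Ordinal) : Prop := γ.card.IsRegular ∧ γ.card.ord = γ

/-- An ordinal which is an inaccessible cardinal (uncountable, regular, strong limit). -/
def IsInaccOrd (γ : Ordinal) : Prop := γ.card.IsInaccessible ∧ γ.card.ord = γ

/-- An inaccessible cardinal `κ` is uplifting if for every ordinal `θ` there is an
inaccessible cardinal `γ ≥ θ` such that `V_κ ≺ V_γ` is a proper elementary extension. -/
def IsUplifting (κ : Ordinal) : Prop :=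
  IsInaccOrd κ ∧ ∀ θ : Ordinal, ∃ γ : Ordinal, IsInaccOrd γ ∧ θ ≤ γ ∧ κ < γ ∧ VElem κ γ

/-- An inaccessible cardinal `κ` is pseudo uplifting if for every ordinal `θ` there is a
cardinal `γ ≥ θ` such that `V_κ ≺ V_γ` is a proper elementary extension. -/
def IsPseudoUplifting (κ : Ordinal) : Prop :=
  IsInaccOrd κ ∧ ∀ θ : Ordinal, ∃ γ : Ordinal, IsCardOrd γ ∧ θ ≤ γ ∧ κ < γ ∧ VElem κ γ

/-- The membership formula `t₁ ∈ t₂` between two terms. -/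
def memBF {α : Type} {n : ℕ} (t₁ t₂ : LSet.Term (α ⊕ Fin n)) : LSet.BoundedFormula α n :=
  Language.adj.boundedFormula₂ t₁ t₂

/-- A formula of the language of set theory all of whose quantifiers are bounded
(of the form `∀ x ∈ t` or `∃ x ∈ t`): the Δ₀ formulas. -/
inductive IsDelta0 : ∀ {α : Type} {n : ℕ}, LSet.BoundedFormula α n → Prop
  | of_isQF {α n} {φ : LSet.BoundedFormula α n} : φ.IsQF → IsDelta0 φ
  | imp {α n} {φ ψ : LSet.BoundedFormula α n} :
      IsDelta0 φ → IsDelta0 ψ → IsDelta0 (φ.imp ψ)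
  | ball {α n} (t : LSet.Term (α ⊕ Fin n)) {φ : LSet.BoundedFormula α (n + 1)} :
      IsDelta0 φ →
      IsDelta0 ((memBF (Term.var (Sum.inr (Fin.last n)))
        (t.relabel (Sum.map id Fin.castSucc)) ⟹ φ).all)
  | bex {α n} (t : LSet.Term (α ⊕ Fin n)) {φ : LSet.BoundedFormula α (n + 1)} :
      IsDelta0 φ →
      IsDelta0 ((memBF (Term.var (Sum.inr (Fin.last n)))
        (t.relabel (Sum.map id Fin.castSucc)) ⊓ φ).ex)

mutual
  /-- Σₖ formulas: `k` alternating blocks of quantifiers beginning with an existential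
  block, followed by a Δ₀ formula (degenerate blocks allowed). -/
  inductive IsSigmaFml : ℕ → ∀ {α : Type} {n : ℕ}, LSet.BoundedFormula α n → Prop
    | of_delta0 {k : ℕ} {α n} {φ : LSet.BoundedFormula α n} : IsDelta0 φ → IsSigmaFml k φ
    | of_pi {k : ℕ} {α n} {φ : LSet.BoundedFormula α n} : IsPiFml k φ → IsSigmaFml (k + 1) φ
    | ex {k : ℕ} {α n} {φ : LSet.BoundedFormula α (n + 1)} :
        IsSigmaFml (k + 1) φ → IsSigmaFml (k + 1) φ.ex
  /-- Πₖ formulas: `k` alternating blocks of quantifiers beginning with a universal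
  block, followed by a Δ₀ formula (degenerate blocks allowed). -/
  inductive IsPiFml : ℕ → ∀ {α : Type} {n : ℕ}, LSet.BoundedFormula α n → Prop
    | of_delta0 {k : ℕ} {α n} {φ : LSet.BoundedFormula α n} : IsDelta0 φ → IsPiFml k φ
    | of_sigma {k : ℕ} {α n} {φ : LSet.BoundedFormula α n} : IsSigmaFml k φ → IsPiFml (k + 1) φ
    | all {k : ℕ} {α n} {φ : LSet.BoundedFormula α (n + 1)} :
        IsPiFml (k + 1) φ → IsPiFml (k + 1) φ.all
end

/-- An inaccessible cardinal `κ` is Σₖ-reflecting if for every Σₖ formula `φ(x)` and every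
`a ∈ V_κ`, `φ(a)` holds in the universe of sets if and only if `V_κ ⊨ φ(a)`. -/
def SigmaReflecting (k : ℕ) (κ : Ordinal) : Prop :=
  IsInaccOrd κ ∧ ∀ φ : LSet.Formula (Fin 1), IsSigmaFml k φ →
    ∀ (a : ZFSet) (ha : a.rank < κ),
      (φ.Realize (fun _ => a) ↔ φ.Realize (fun _ => (⟨a, ha⟩ : Vt κ)))

/-- Truth of a formula in the class `P` of sets, with the membership relation. -/
def Tr (P : Set ZFSet.{0}) {A : Type} : ∀ {n : ℕ}, LSet.BoundedFormula A n →
    (A → ZFSet.{0}) → (Fin n → ZFSet.{0}) → Prop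
  | _, .falsum, _, _ => False
  | _, .equal t₁ t₂, v, xs => t₁.realize (Sum.elim v xs) = t₂.realize (Sum.elim v xs)
  | _, .rel R ts, v, xs => Structure.RelMap R fun i => (ts i).realize (Sum.elim v xs)
  | _, .imp f g, v, xs => Tr P f v xs → Tr P g v xs
  | _, .all f, v, xs => ∀ x ∈ P, Tr P f v (Fin.snoc xs x)

section Tr

variable {P Q : Set ZFSet.{0}} {A : Type} {n : ℕ} {v : A → ZFSet.{0}} {xs : Fin n → ZFSet.{0}}

theorem tr_imp {φ ψ : LSet.BoundedFormula A n} :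
    Tr P (φ.imp ψ) v xs ↔ (Tr P φ v xs → Tr P ψ v xs) := Iff.rfl

theorem tr_all {φ : LSet.BoundedFormula A (n + 1)} :
    Tr P φ.all v xs ↔ ∀ x ∈ P, Tr P φ v (Fin.snoc xs x) := Iff.rfl

theorem tr_ex {φ : LSet.BoundedFormula A (n + 1)} :
    Tr P φ.ex v xs ↔ ∃ x ∈ P, Tr P φ v (Fin.snoc xs x) := by
  change ¬ (∀ x ∈ P, ¬ Tr P φ v (Fin.snoc xs x)) ↔ _
  push Not
  rfl

theorem tr_inf {φ ψ : LSet.BoundedFormula A n} :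
    Tr P (φ ⊓ ψ) v xs ↔ Tr P φ v xs ∧ Tr P ψ v xs := by
  change ¬ (Tr P φ v xs → ¬ Tr P ψ v xs) ↔ _
  tauto

theorem tr_memBF {t₁ t₂ : LSet.Term (A ⊕ Fin n)} :
    Tr P (memBF t₁ t₂) v xs ↔
      t₁.realize (Sum.elim v xs) ∈ t₂.realize (Sum.elim v xs) := Iff.rfl

theorem snoc_mem {x : ZFSet.{0}} (hxs : ∀ i, xs i ∈ P) (hx : x ∈ P) (i : Fin (n + 1)) :
    (Fin.snoc xs x : Fin (n + 1) → ZFSet.{0}) i ∈ P := by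
  refine Fin.lastCases ?_ (fun i => ?_) i
  · simpa using hx
  · simpa using hxs i

theorem term_realize_mem {t : LSet.Term (A ⊕ Fin n)} (hv : ∀ a, v a ∈ P) (hxs : ∀ i, xs i ∈ P) :
    t.realize (Sum.elim v xs) ∈ P := by
  rcases t with (a | i) | ⟨f, _⟩
  · exact hv a
  · exact hxs i
  · exact f.elim

theorem term_realize_weaken {t : LSet.Term (A ⊕ Fin n)} {x : ZFSet.{0}} :
    (t.relabel (Sum.map id Fin.castSucc)).realize
      (Sum.elim v (Fin.snoc xs x : Fin (n + 1) → ZFSet.{0})) = t.realize (Sum.elim v xs) := by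
  rw [Term.realize_relabel]
  congr 1
  funext i
  rcases i with a | i <;> simp

/-- A class of sets containing the elements of its members. -/
def TransClass (P : Set ZFSet.{0}) : Prop := ∀ x ∈ P, ∀ y ∈ x, y ∈ P

/-- Bounded formulas are absolute between transitive classes. -/
theorem IsDelta0.absolute {φ : LSet.BoundedFormula A n} (h : IsDelta0 φ) (hPQ : P ⊆ Q)
    (hP : TransClass P) (hv : ∀ a, v a ∈ P) (hxs : ∀ i, xs i ∈ P) :
    Tr P φ v xs ↔ Tr Q φ v xs := by
  induction h with
  | of_isQF h =>
    induction h with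
    | falsum => rfl
    | of_isAtomic h => cases h <;> rfl
    | imp _ _ ih₁ ih₂ => exact imp_congr ih₁ ih₂
  | imp _ _ ih₁ ih₂ => exact imp_congr (ih₁ hxs) (ih₂ hxs)
  | ball t _ ih =>
    simp only [tr_all, tr_imp, tr_memBF, term_realize_weaken, Term.realize_var, Sum.elim_inr,
      Fin.snoc_last]
    refine ⟨fun H x _ hx => ?_, fun H x hxP hx => ?_⟩
    · have hxP := hP _ (term_realize_mem hv hxs) x hx
      exact (ih (snoc_mem hxs hxP)).1 (H x hxP hx)
    · exact (ih (snoc_mem hxs hxP)).2 (H x (hPQ hxP) hx)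
  | bex t _ ih =>
    simp only [tr_ex, tr_inf, tr_memBF, term_realize_weaken, Term.realize_var, Sum.elim_inr,
      Fin.snoc_last]
    refine ⟨fun ⟨x, hxP, hx, H⟩ => ⟨x, hPQ hxP, hx, (ih (snoc_mem hxs hxP)).1 H⟩,
      fun ⟨x, _, hx, H⟩ => ?_⟩
    have hxP := hP _ (term_realize_mem hv hxs) x hx
    exact ⟨x, hxP, hx, (ih (snoc_mem hxs hxP)).2 H⟩

end Tr

/-- A structure isomorphic to a class of sets satisfies what is true in that class. -/
theorem realize_iff_tr {M : Type*} [LSet.Structure M] (f : M → ZFSet.{0})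
    (hf : Function.Injective f)
    (hmem : ∀ x : Fin 2 → M,
      Structure.RelMap (L := LSet) (M := M) Language.adj x ↔ f (x 0) ∈ f (x 1))
    {A : Type} {n : ℕ} (φ : LSet.BoundedFormula A n) (v : A → M) (xs : Fin n → M) :
    φ.Realize v xs ↔ Tr (Set.range f) φ (f ∘ v) (f ∘ xs) := by
  have hterm {n : ℕ} (xs : Fin n → M) (t : LSet.Term (A ⊕ Fin n)) :
      f (t.realize (Sum.elim v xs)) = t.realize (Sum.elim (f ∘ v) (f ∘ xs)) := by
    rcases t with (a | i) | ⟨g, _⟩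
    · rfl
    · rfl
    · exact g.elim
  induction φ with
  | falsum => rfl
  | equal t₁ t₂ =>
    change t₁.realize _ = t₂.realize _ ↔ t₁.realize _ = t₂.realize _
    rw [← hterm, ← hterm, hf.eq_iff]
  | rel R ts =>
    cases R
    change Structure.RelMap (L := LSet) (M := M) Language.adj _ ↔
      (ts 0).realize _ ∈ (ts 1).realize _
    rw [hmem, ← hterm, ← hterm]
  | imp _ _ ih₁ ih₂ => exact imp_congr (ih₁ xs) (ih₂ xs)
  | all φ ih =>
    rw [BoundedFormula.realize_all, tr_all, Set.forall_mem_range]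
    refine forall_congr' fun a => ?_
    rw [← Fin.comp_snoc]
    exact ih _

theorem realize_zfset_iff {A : Type} {n : ℕ} (φ : LSet.BoundedFormula A n)
    (v : A → ZFSet.{0}) (xs : Fin n → ZFSet.{0}) :
    φ.Realize v xs ↔ Tr Set.univ φ v xs := by
  simpa using realize_iff_tr id Function.injective_id (fun _ => Iff.rfl) φ v xs

/-- The class of sets of rank less than `α`. -/
def Vset (α : Ordinal.{0}) : Set ZFSet.{0} := {x | x.rank < α}

theorem mem_Vset {α : Ordinal.{0}} {x : ZFSet.{0}} : x ∈ Vset α ↔ x.rank < α := Iff.rfl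

theorem transClass_Vset (α : Ordinal.{0}) : TransClass (Vset α) :=
  fun _ hx _ hy => (ZFSet.rank_lt_of_mem hy).trans hx

theorem realize_vt_iff {α : Ordinal.{0}} {A : Type} {n : ℕ} (φ : LSet.BoundedFormula A n)
    (v : A → Vt α) (xs : Fin n → Vt α) :
    φ.Realize v xs ↔ Tr (Vset α) φ (fun a => (v a).1) (fun i => (xs i).1) := by
  have := realize_iff_tr (M := Vt α) Subtype.val Subtype.val_injective (fun _ => Iff.rfl) φ v xs
  have hr : Set.range (Subtype.val : Vt α → ZFSet.{0}) = Vset α := Subtype.range_coe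
  rwa [hr] at this

mutual
  theorem IsSigmaFml.exists_neg {A : Type} : ∀ {k n : ℕ} {φ : LSet.BoundedFormula A n},
      IsSigmaFml k φ → ∃ ψ : LSet.BoundedFormula A n, IsPiFml k ψ ∧
        ∀ P v xs, Tr P ψ v xs ↔ ¬ Tr P φ v xs
    | _, _, φ, .of_delta0 h =>
      ⟨∼φ, .of_delta0 (h.imp (.of_isQF .falsum)), fun _ _ _ => Iff.rfl⟩
    | _, _, _, .of_pi h =>
      have ⟨ψ, hψ, H⟩ := h.exists_neg
      ⟨ψ, .of_sigma hψ, H⟩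
    | _, _, _, .ex h =>
      have ⟨ψ, hψ, H⟩ := h.exists_neg
      ⟨ψ.all, .all hψ, fun P v xs => by simp [tr_all, tr_ex, H]⟩
  theorem IsPiFml.exists_neg {A : Type} : ∀ {k n : ℕ} {φ : LSet.BoundedFormula A n},
      IsPiFml k φ → ∃ ψ : LSet.BoundedFormula A n, IsSigmaFml k ψ ∧
        ∀ P v xs, Tr P ψ v xs ↔ ¬ Tr P φ v xs
    | _, _, φ, .of_delta0 h =>
      ⟨∼φ, .of_delta0 (h.imp (.of_isQF .falsum)), fun _ _ _ => Iff.rfl⟩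
    | _, _, _, .of_sigma h =>
      have ⟨ψ, hψ, H⟩ := h.exists_neg
      ⟨ψ, .of_pi hψ, H⟩
    | _, _, _, .all h =>
      have ⟨ψ, hψ, H⟩ := h.exists_neg
      ⟨ψ.ex, .ex hψ, fun P v xs => by simp [tr_all, tr_ex, H]⟩
end

/-- An induction principle for the outer existential block of a `Σ_{k+1}` formula. -/
theorem IsSigmaFml.block_induction {A : Type} {k : ℕ}
    {C : ∀ n : ℕ, LSet.BoundedFormula A n → Prop}
    (hdelta : ∀ n φ, IsDelta0 φ → C n φ) (hpi : ∀ n φ, IsPiFml k φ → C n φ)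
    (hex : ∀ n φ, C (n + 1) φ → C n φ.ex) :
    ∀ {n : ℕ} {φ : LSet.BoundedFormula A n}, IsSigmaFml (k + 1) φ → C n φ
  | _, _, .of_delta0 h => hdelta _ _ h
  | _, _, .of_pi h => hpi _ _ h
  | _, _, .ex h => hex _ _ (h.block_induction hdelta hpi hex)

/-- `Σ_k` formulas go up from `P` to `Q`. -/
def SigmaUp (A : Type) (k : ℕ) (P Q : Set ZFSet.{0}) : Prop :=
  ∀ (n : ℕ) (φ : LSet.BoundedFormula A n), IsSigmaFml k φ → ∀ (v : A → ZFSet.{0})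
    (xs : Fin n → ZFSet.{0}), (∀ a, v a ∈ P) → (∀ i, xs i ∈ P) → Tr P φ v xs → Tr Q φ v xs

/-- `Σ_k` formulas with parameters in `P` go down from `Q` to `P`. -/
def SigmaDown (A : Type) (k : ℕ) (P Q : Set ZFSet.{0}) : Prop :=
  ∀ (n : ℕ) (φ : LSet.BoundedFormula A n), IsSigmaFml k φ → ∀ (v : A → ZFSet.{0})
    (xs : Fin n → ZFSet.{0}), (∀ a, v a ∈ P) → (∀ i, xs i ∈ P) → Tr Q φ v xs → Tr P φ v xs

section

variable {A : Type} {k : ℕ} {P Q : Set ZFSet.{0}}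

theorem sigmaUp_zero (hPQ : P ⊆ Q) (hP : TransClass P) : SigmaUp A 0 P Q := by
  intro n φ h v xs hv hxs
  cases h with
  | of_delta0 h => exact (h.absolute hPQ hP hv hxs).1

theorem sigmaDown_zero (hPQ : P ⊆ Q) (hP : TransClass P) : SigmaDown A 0 P Q := by
  intro n φ h v xs hv hxs
  cases h with
  | of_delta0 h => exact (h.absolute hPQ hP hv hxs).2

theorem SigmaDown.sigmaUp_succ (h : SigmaDown A k P Q) (hPQ : P ⊆ Q) (hP : TransClass P) :
    SigmaUp A (k + 1) P Q := by
  intro n φ hφ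
  refine hφ.block_induction (C := fun n φ => ∀ (v : A → ZFSet.{0}) (xs : Fin n → ZFSet.{0}),
    (∀ a, v a ∈ P) → (∀ i, xs i ∈ P) → Tr P φ v xs → Tr Q φ v xs) ?_ ?_ ?_
  · exact fun n φ hφ v xs hv hxs => (hφ.absolute hPQ hP hv hxs).1
  · intro n φ hφ v xs hv hxs H
    obtain ⟨ψ, hψ, hneg⟩ := hφ.exists_neg
    by_contra hQ
    exact (hneg _ _ _).1 (h n ψ hψ v xs hv hxs ((hneg _ _ _).2 hQ)) H
  · intro n φ ih v xs hv hxs H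
    obtain ⟨x, hx, H⟩ := tr_ex.1 H
    exact tr_ex.2 ⟨x, hPQ hx, ih v _ hv (snoc_mem hxs hx) H⟩

theorem TransClass.left_mem_of_pair_mem (hP : TransClass P) {x y : ZFSet.{0}}
    (h : x.pair y ∈ P) : x ∈ P :=
  hP _ (hP _ h {x} (by simp [ZFSet.pair])) x (by simp)

theorem TransClass.right_mem_of_pair_mem (hP : TransClass P) {x y : ZFSet.{0}}
    (h : x.pair y ∈ P) : y ∈ P :=
  hP _ (hP _ h {x, y} (by simp [ZFSet.pair])) y (by simp)

/-- A `Σ_{k+1}` formula true in `Q` is true in all large enough transitive `P ⊆ Q` from which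
`Σ_k` formulas go up to `Q`. -/
theorem IsSigmaFml.exists_witness {n : ℕ} {φ : LSet.BoundedFormula A n}
    (hφ : IsSigmaFml (k + 1) φ) (hQ : ∀ x ∈ Q, ∀ y ∈ Q, x.pair y ∈ Q) (hne : Q.Nonempty)
    {v : A → ZFSet.{0}} {xs : Fin n → ZFSet.{0}} (H : Tr Q φ v xs) :
    ∃ w ∈ Q, ∀ P ⊆ Q, TransClass P → SigmaUp A k P Q → w ∈ P → (∀ a, v a ∈ P) →
      (∀ i, xs i ∈ P) → Tr P φ v xs := by
  refine hφ.block_induction (C := fun n φ => ∀ (xs : Fin n → ZFSet.{0}),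
    Tr Q φ v xs → ∃ w ∈ Q, ∀ P ⊆ Q, TransClass P → SigmaUp A k P Q → w ∈ P → (∀ a, v a ∈ P) →
      (∀ i, xs i ∈ P) → Tr P φ v xs) ?_ ?_ ?_ xs H
  · intro n φ hφ xs H
    obtain ⟨w, hw⟩ := hne
    exact ⟨w, hw, fun P hPQ hP _ _ hv hxs => (hφ.absolute hPQ hP hv hxs).2 H⟩
  · intro n φ hφ xs H
    obtain ⟨w, hw⟩ := hne
    refine ⟨w, hw, fun P hPQ hP hup _ hv hxs => ?_⟩
    obtain ⟨ψ, hψ, hneg⟩ := hφ.exists_neg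
    by_contra hF
    exact (hneg _ _ _).1 (hup n ψ hψ v xs hv hxs ((hneg _ _ _).2 hF)) H
  · intro n φ ih xs H
    obtain ⟨x, hx, H⟩ := tr_ex.1 H
    obtain ⟨w, hw, hw'⟩ := ih _ H
    refine ⟨x.pair w, hQ _ hx _ hw, fun P hPQ hP hup hxw hv hxs => ?_⟩
    have hxP := hP.left_mem_of_pair_mem hxw
    exact tr_ex.2 ⟨x, hxP, hw' P hPQ hP hup (hP.right_mem_of_pair_mem hxw) hv (snoc_mem hxs hxP)⟩

end

theorem rank_ordered_pair (x y : ZFSet.{0}) :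
    (x.pair y).rank = Order.succ (Order.succ (max x.rank y.rank)) := by
  simp only [ZFSet.pair, ZFSet.rank_insert, ZFSet.rank_singleton]
  rw [← Order.succ_max, max_comm _ (Order.succ _), ← Order.succ_max, ← Order.succ_max]
  congr 2
  rw [max_comm y.rank, ← max_assoc, max_self]

theorem rank_pair_lt {α : Ordinal.{0}} (hα : Order.IsSuccLimit α) {x y : ZFSet.{0}}
    (hx : x.rank < α) (hy : y.rank < α) : (x.pair y).rank < α := by
  rw [rank_ordered_pair]
  exact hα.succ_lt (hα.succ_lt (max_lt hx hy))

theorem IsInaccOrd.isSuccLimit {γ : Ordinal.{0}} (h : IsInaccOrd γ) : Order.IsSuccLimit γ := by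
  rw [← h.2]
  exact Cardinal.isSuccLimit_ord h.1.1.le

theorem IsInaccOrd.omega0_lt {γ : Ordinal.{0}} (h : IsInaccOrd γ) : Ordinal.omega0 < γ := by
  rw [← h.2, ← Cardinal.ord_aleph0]
  exact Cardinal.ord_lt_ord.2 h.1.1

theorem IsInaccOrd.card_vonNeumann_lt {γ α : Ordinal.{0}} (h : IsInaccOrd γ) (hα : α < γ) :
    (ZFSet.vonNeumann α).card < γ.card := by
  rw [ZFSet.card_vonNeumann]
  have := h.1.preBeth_ord
  rw [h.2] at this
  rw [← this]
  exact Cardinal.preBeth_strictMono hα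

instance small_mem_and (P : Set ZFSet.{0}) (x : ZFSet.{0}) :
    Small.{0} {y : ZFSet.{0} // y ∈ x ∧ y ∈ P} :=
  small_of_injective (β := x) (f := fun y => ⟨y.1, y.2.1⟩) fun a b h => by
    simpa [Subtype.ext_iff] using h

/-- The Mostowski collapse of a class `P`. -/
noncomputable def collapse (P : Set ZFSet.{0}) (x : ZFSet.{0}) : ZFSet.{0} :=
  ZFSet.range fun y : {y : ZFSet.{0} // y ∈ x ∧ y ∈ P} => collapse P y.1
termination_by x
decreasing_by exact y.2.1

theorem mem_collapse {P : Set ZFSet.{0}} {x z : ZFSet.{0}} :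
    z ∈ collapse P x ↔ ∃ y ∈ x, y ∈ P ∧ collapse P y = z := by
  rw [collapse, ZFSet.mem_range]
  simp [and_assoc]

theorem collapse_injOn {P : Set ZFSet.{0}}
    (hext : ∀ x ∈ P, ∀ y ∈ P, (∀ z ∈ P, z ∈ x ↔ z ∈ y) → x = y) : Set.InjOn (collapse P) P := by
  intro x hx
  induction x using ZFSet.inductionOn with
  | _ x ih =>
  intro y hy h
  refine hext x hx y hy fun z hz => ⟨fun hzx => ?_, fun hzy => ?_⟩
  · obtain ⟨w, hw, hwP, hwz⟩ := mem_collapse.1 (h ▸ mem_collapse.2 ⟨z, hzx, hz, rfl⟩)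
    rwa [ih z hzx hz hwP hwz.symm]
  · obtain ⟨w, hw, hwP, hwz⟩ := mem_collapse.1 (h.symm ▸ mem_collapse.2 ⟨z, hzy, hz, rfl⟩)
    rwa [← ih w hw hwP hz hwz]

theorem collapse_mem_iff {P : Set ZFSet.{0}} (hinj : Set.InjOn (collapse P) P) {x y : ZFSet.{0}}
    (hx : x ∈ P) : collapse P x ∈ collapse P y ↔ x ∈ y := by
  refine ⟨fun h => ?_, fun h => mem_collapse.2 ⟨x, h, hx, rfl⟩⟩
  obtain ⟨w, hw, hwP, hwz⟩ := mem_collapse.1 h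
  rwa [← hinj hwP hx hwz]

theorem collapse_eq_self {P R : Set ZFSet.{0}} (hR : TransClass R) (hRP : R ⊆ P) {x : ZFSet.{0}}
    (hx : x ∈ R) : collapse P x = x := by
  induction x using ZFSet.inductionOn with
  | _ x ih =>
  ext z
  rw [mem_collapse]
  refine ⟨?_, fun h => ⟨z, h, hRP (hR _ hx _ h), ih z h (hR _ hx _ h)⟩⟩
  rintro ⟨y, hy, -, rfl⟩
  rwa [ih y hy (hR _ hx _ hy)]

theorem transClass_image_collapse (P : Set ZFSet.{0}) : TransClass (collapse P '' P) := by
  rintro _ ⟨x, -, rfl⟩ y hy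
  obtain ⟨w, -, hwP, rfl⟩ := mem_collapse.1 hy
  exact ⟨w, hwP, rfl⟩

theorem TransClass.exists_rank_eq {T : Set ZFSet.{0}} (hT : TransClass T) {t : ZFSet.{0}}
    (ht : t ∈ T) {o : Ordinal.{0}} (ho : o ≤ t.rank) : ∃ u ∈ T, u.rank = o := by
  induction t using ZFSet.inductionOn with
  | _ t ih =>
  rcases ho.eq_or_lt with rfl | ho
  · exact ⟨t, ht, rfl⟩
  · obtain ⟨y, hy, hoy⟩ := ZFSet.lt_rank_iff.1 ho
    exact ih y hy (hT _ ht _ hy) hoy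

/-- A transitive class of cardinality less than `γ` consists of sets of rank less than `γ`. -/
theorem TransClass.subset_Vset {T : Set ZFSet.{0}} (hT : TransClass T) {γ : Ordinal.{0}}
    (hcard : Cardinal.mk T < Cardinal.lift.{1} γ.card) : T ⊆ Vset γ := by
  intro t ht
  by_contra hγ
  rw [mem_Vset, not_lt] at hγ
  refine hcard.not_ge ?_
  choose f hf hrank using fun o : Set.Iio γ => hT.exists_rank_eq ht (o.2.le.trans hγ)
  rw [← Cardinal.mk_Iio_ordinal]
  refine Cardinal.mk_le_of_injective (f := fun o => (⟨f o, hf o⟩ : T)) fun a b h => ?_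
  have := congrArg (fun t : T => t.1.rank) h
  simpa [hrank, Subtype.ext_iff] using this

/-- Extensionality passes to elementary substructures. -/
theorem ext_of_elementarySubstructure {δ : Ordinal.{0}} (S : LSet.ElementarySubstructure (Vt δ))
    {x y : Vt δ} (hx : x ∈ S) (hy : y ∈ S)
    (h : ∀ z ∈ S, z.1 ∈ x.1 ↔ z.1 ∈ y.1) : x = y := by
  let φ : LSet.Formula (Fin 2) :=
    ((memBF (&0) (Term.var (Sum.inl 0))).iff (memBF (&0) (Term.var (Sum.inl 1)))).all
  have hφ : φ.Realize (![⟨x, hx⟩, ⟨y, hy⟩] : Fin 2 → S) := by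
    intro z
    rw [BoundedFormula.realize_iff]
    exact h z.1 z.2
  have hφ' := (S.subtype.map_formula φ _).2 hφ
  rw [← Subtype.coe_inj]
  ext z
  have hz (w : Vt δ) : w.1 ∈ x.1 ↔ w.1 ∈ y.1 := by
    have := hφ' w
    rw [BoundedFormula.realize_iff] at this
    exact this
  exact ⟨fun h => (hz ⟨z, (ZFSet.rank_lt_of_mem h).trans x.2⟩).1 h,
    fun h => (hz ⟨z, (ZFSet.rank_lt_of_mem h).trans y.2⟩).2 h⟩

theorem card_LSet_le : LSet.card ≤ Cardinal.aleph0 := by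
  have h (n : ℕ) : Countable (LSet.Functions n) := inferInstanceAs (Countable Empty)
  have : Countable LSet.Symbols :=
    inferInstanceAs (Countable ((Σ n, LSet.Functions n) ⊕ (Σ n, LSet.Relations n)))
  exact Cardinal.mk_le_aleph0

theorem mk_Vset (α : Ordinal.{0}) :
    Cardinal.mk (Vset α) = Cardinal.lift.{1} (ZFSet.vonNeumann α).card := by
  rw [← ZFSet.cardinalMk_coe_sort]
  exact Cardinal.mk_congr (Equiv.subtypeEquivRight fun x => ZFSet.mem_vonNeumann.symm)

/-- `Σ₁` formulas reflect to `V_γ` for inaccessible `γ`. -/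
theorem IsInaccOrd.sigmaDown_one {γ : Ordinal.{0}} (hγ : IsInaccOrd γ) {A : Type} [Finite A] :
    SigmaDown A 1 (Vset γ) Set.univ := by
  intro n φ hφ v xs hv hxs H
  obtain ⟨w, -, hw⟩ := hφ.exists_witness (Q := Set.univ) (fun _ _ _ _ => trivial) ⟨∅, trivial⟩ H
  obtain ⟨α, hαγ, hωα, hvα, hxα⟩ : ∃ α < γ, Ordinal.omega0 ≤ α ∧ (∀ a, (v a) ∈ Vset α) ∧
      ∀ i, xs i ∈ Vset α := by
    have hlim := hγ.isSuccLimit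
    obtain ⟨o₁, h₁, h₁'⟩ : ∃ o < γ, ∀ a, (v a).rank ≤ o := by
      cases nonempty_fintype A
      exact ⟨Finset.univ.sup fun a => (v a).rank, (Finset.sup_lt_iff hlim.bot_lt).2 fun a _ => hv a,
        fun a => Finset.le_sup (f := fun a => (v a).rank) (Finset.mem_univ a)⟩
    obtain ⟨o₂, h₂, h₂'⟩ : ∃ o < γ, ∀ i, (xs i).rank ≤ o :=
      ⟨Finset.univ.sup fun a => (xs a).rank, (Finset.sup_lt_iff hlim.bot_lt).2 fun a _ => hxs a,
        fun a => Finset.le_sup (f := fun a => (xs a).rank) (Finset.mem_univ a)⟩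
    refine ⟨Order.succ (max Ordinal.omega0 (max o₁ o₂)),
      hlim.succ_lt (max_lt hγ.omega0_lt (max_lt h₁ h₂)), (le_max_left _ _).trans (Order.le_succ _),
      fun a => Order.lt_succ_iff.2 ((h₁' a).trans ?_),
      fun i => Order.lt_succ_iff.2 ((h₂' i).trans ?_)⟩
    · exact (le_max_left _ _).trans (le_max_right _ _)
    · exact (le_max_right _ _).trans (le_max_right _ _)
  let δ : Ordinal.{0} := max γ (Order.succ w.rank)
  have hαδ : Vset α ⊆ Vset δ := fun x hx => (hx.trans hαγ).trans_le (le_max_left _ _)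
  have hδ : Tr (Vset δ) φ v xs :=
    hw _ (Set.subset_univ _) (transClass_Vset δ)
      (sigmaUp_zero (Set.subset_univ _) (transClass_Vset δ))
      (mem_Vset.2 ((Order.lt_succ _).trans_le (le_max_right _ _))) (fun a => hαδ (hvα a))
      (fun i => hαδ (hxα i))
  let c : Cardinal.{1} := Cardinal.mk (Vset α)
  have hc : Cardinal.mk (Subtype.val ⁻¹' Vset α : Set (Vt δ)) = c := by
    refine Cardinal.mk_preimage_of_injective_of_subset_range _ _ Subtype.val_injective ?_
    exact fun x hx => ⟨⟨x, hαδ hx⟩, rfl⟩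
  have hinf : Cardinal.aleph0 ≤ c := by
    simp only [c, mk_Vset, Cardinal.aleph0_le_lift]
    refine le_trans ?_ α.card_le_card_vonNeumann
    exact Ordinal.aleph0_le_card.2 hωα
  obtain ⟨S, hsS, hScard⟩ := exists_elementarySubstructure_card_eq LSet
    (Subtype.val ⁻¹' Vset α : Set (Vt δ)) c hinf (by rw [hc])
    (by
      refine le_trans ?_ (Cardinal.lift_le.2 hinf)
      simpa using card_LSet_le)
    (by
      rw [Cardinal.lift_id, Cardinal.lift_id, ← hc]
      exact Cardinal.mk_set_le _)
  have hSc : Cardinal.mk S = c := by simpa using hScard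
  let P : Set ZFSet.{0} := Subtype.val '' (S : Set (Vt δ))
  have hVP : Vset α ⊆ P := fun x hx => ⟨⟨x, hαδ hx⟩, hsS hx, rfl⟩
  have hinj : Set.InjOn (collapse P) P := by
    refine collapse_injOn ?_
    rintro _ ⟨x, hx, rfl⟩ _ ⟨y, hy, rfl⟩ h
    rw [ext_of_elementarySubstructure S hx hy fun z hz => h z.1 ⟨z, hz, rfl⟩]
  let f : S → ZFSet.{0} := fun x => collapse P x.1.1
  have hfP (x : S) : x.1.1 ∈ P := ⟨x.1, x.2, rfl⟩
  have hrange : Set.range f = collapse P '' P := by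
    ext z
    simp [f, P]
  let v' : A → S := fun a => ⟨⟨v a, hαδ (hvα a)⟩, hsS (hvα a)⟩
  let xs' : Fin n → S := fun i => ⟨⟨xs i, hαδ (hxα i)⟩, hsS (hxα i)⟩
  have hT : Tr (collapse P '' P) φ v xs := by
    have hS : φ.Realize v' xs' := by
      refine (S.subtype.map_boundedFormula φ v' xs').1 ?_
      exact (realize_vt_iff φ _ _).2 hδ
    rw [realize_iff_tr f
      (fun x y h => Subtype.ext (Subtype.ext (hinj (hfP x) (hfP y) h)))
      (fun x => (collapse_mem_iff hinj (hfP (x 0))).symm), hrange] at hS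
    convert hS using 1
    · exact funext fun a => (collapse_eq_self (transClass_Vset α) hVP (hvα a)).symm
    · exact funext fun i => (collapse_eq_self (transClass_Vset α) hVP (hxα i)).symm
  have htrans := transClass_image_collapse P
  have hsub : collapse P '' P ⊆ Vset γ := by
    refine htrans.subset_Vset ?_
    rw [← hrange]
    refine Cardinal.mk_range_le.trans_lt ?_
    rw [hSc]
    simp only [c, mk_Vset, Cardinal.lift_lt]
    exact hγ.card_vonNeumann_lt hαγ
  have hmem {x : ZFSet.{0}} (hx : x ∈ Vset α) : x ∈ collapse P '' P :=
    ⟨x, hVP hx, collapse_eq_self (transClass_Vset α) hVP hx⟩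
  exact (sigmaDown_zero hsub htrans).sigmaUp_succ hsub htrans n φ hφ v xs
    (fun a => hmem (hvα a)) (fun i => hmem (hxα i)) hT

theorem VElem.tr_iff {κ γ : Ordinal.{0}} (h : VElem κ γ) {A : Type} {n : ℕ}
    (φ : LSet.BoundedFormula A n) {v : A → ZFSet.{0}} {xs : Fin n → ZFSet.{0}}
    (hv : ∀ a, v a ∈ Vset κ) (hxs : ∀ i, xs i ∈ Vset κ) :
    Tr (Vset κ) φ v xs ↔ Tr (Vset γ) φ v xs := by
  obtain ⟨e, he⟩ := h
  have := e.map_boundedFormula φ (fun a => ⟨v a, hv a⟩) (fun i => ⟨xs i, hxs i⟩)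
  simp only [realize_vt_iff, Function.comp_apply, he] at this
  exact this.symm

/-- If `Σ_k` formulas go up from the targets `V_γ` to the universe, then `Σ_{k+1}` formulas
go down to `V_κ`. -/
theorem IsUplifting.sigmaDown_succ {κ : Ordinal.{0}} (h : IsUplifting κ) {A : Type} {k : ℕ}
    (hup : ∀ γ, IsInaccOrd γ → SigmaUp A k (Vset γ) Set.univ) :
    SigmaDown A (k + 1) (Vset κ) Set.univ := by
  intro n φ hφ v xs hv hxs H
  obtain ⟨w, -, hw⟩ :=
    hφ.exists_witness (Q := Set.univ) (fun _ _ _ _ => trivial) ⟨∅, trivial⟩ H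
  obtain ⟨γ, hγ, hwγ, hκγ, helem⟩ := h.2 (Order.succ w.rank)
  rw [helem.tr_iff φ hv hxs]
  exact hw _ (Set.subset_univ _) (transClass_Vset γ) (hup γ hγ)
    (mem_Vset.2 ((Order.lt_succ _).trans_le hwγ)) (fun a => lt_trans (hv a) hκγ)
    (fun i => lt_trans (hxs i) hκγ)

theorem IsUplifting.sigmaDown_three {κ : Ordinal.{0}} (h : IsUplifting κ) {A : Type} [Finite A] :
    SigmaDown A 3 (Vset κ) Set.univ :=
  h.sigmaDown_succ fun γ hγ =>
    hγ.sigmaDown_one.sigmaUp_succ (Set.subset_univ _) (transClass_Vset γ)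

theorem IsUplifting.sigmaUp_three {κ : Ordinal.{0}} (h : IsUplifting κ) {A : Type} :
    SigmaUp A 3 (Vset κ) Set.univ :=
  (h.sigmaDown_succ fun γ _ => (sigmaDown_zero (Set.subset_univ _)
    (transClass_Vset γ)).sigmaUp_succ (Set.subset_univ _) (transClass_Vset γ)).sigmaUp_succ
    (Set.subset_univ _) (transClass_Vset κ)

/-- A relation on the levels `V_α`, `α` a limit, which is uniformly definable by a formula. -/
def Dfn {ι : Type} (R : Ordinal.{0} → (ι → ZFSet.{0}) → Prop) : Prop :=
  ∃ φ : LSet.Formula ι, ∀ α, Order.IsSuccLimit α → ∀ v : ι → Vt α,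
    φ.Realize v ↔ R α fun i => (v i).1

/-- A function on assignments which evaluates a variable. -/
def IsVar {ι : Type} (f : (ι → ZFSet.{0}) → ZFSet.{0}) : Prop := ∃ i, ∀ v, f v = v i

theorem Dfn.elementary {ι : Type} {R : Ordinal.{0} → (ι → ZFSet.{0}) → Prop} (hR : Dfn R)
    {κ γ : Ordinal.{0}} (h : VElem κ γ) (hκ : Order.IsSuccLimit κ) (hγ : Order.IsSuccLimit γ)
    {v : ι → ZFSet.{0}} (hv : ∀ i, (v i).rank < κ) : R κ v ↔ R γ v := by
  obtain ⟨φ, hφ⟩ := hR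
  obtain ⟨e, he⟩ := h
  have h₁ := hφ κ hκ fun i => ⟨v i, hv i⟩
  have h₂ := hφ γ hγ (e ∘ fun i => ⟨v i, hv i⟩)
  simp only [Function.comp_apply, he] at h₂
  exact h₁.symm.trans ((e.map_formula φ _).symm.trans h₂)

section Dfn

variable {ι : Type} {R R' : Ordinal.{0} → (ι → ZFSet.{0}) → Prop}
  {f g h : (ι → ZFSet.{0}) → ZFSet.{0}}

theorem isVar_proj (i : ι) : IsVar fun v : ι → ZFSet.{0} => v i := ⟨i, fun _ => rfl⟩

theorem IsVar.weaken (hf : IsVar f) :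
    IsVar fun w : ι ⊕ Unit → ZFSet.{0} => f fun i => w (Sum.inl i) := by
  obtain ⟨i, hi⟩ := hf
  exact ⟨Sum.inl i, fun v => hi _⟩

theorem isVar_new : IsVar fun w : ι ⊕ Unit → ZFSet.{0} => w (Sum.inr ()) := isVar_proj _

theorem Dfn.congr (hR : Dfn R)
    (H : ∀ α, Order.IsSuccLimit α → ∀ v : ι → ZFSet.{0}, (∀ i, (v i).rank < α) →
      (R' α v ↔ R α v)) : Dfn R' := by
  obtain ⟨φ, hφ⟩ := hR
  exact ⟨φ, fun α hα v => (hφ α hα v).trans (H α hα _ fun i => (v i).2).symm⟩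

theorem dfn_mem (hf : IsVar f) (hg : IsVar g) : Dfn fun _ v => f v ∈ g v := by
  obtain ⟨i, hi⟩ := hf
  obtain ⟨j, hj⟩ := hg
  refine ⟨memBF (Term.var (Sum.inl i)) (Term.var (Sum.inl j)), fun α _ v => ?_⟩
  simp only [hi, hj]
  rfl

theorem dfn_eq (hf : IsVar f) (hg : IsVar g) : Dfn fun _ v => f v = g v := by
  obtain ⟨i, hi⟩ := hf
  obtain ⟨j, hj⟩ := hg
  refine ⟨Term.equal (Term.var i) (Term.var j), fun α _ v => ?_⟩
  simp [hi, hj, Formula.realize_equal, Subtype.ext_iff]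

theorem Dfn.not (hR : Dfn R) : Dfn fun α v => ¬ R α v := by
  obtain ⟨φ, hφ⟩ := hR
  exact ⟨∼φ, fun α hα v => by rw [Formula.realize_not, hφ α hα]⟩

theorem Dfn.imp (hR : Dfn R) (hR' : Dfn R') : Dfn fun α v => R α v → R' α v := by
  obtain ⟨φ, hφ⟩ := hR
  obtain ⟨ψ, hψ⟩ := hR'
  exact ⟨φ.imp ψ, fun α hα v => by rw [Formula.realize_imp, hφ α hα, hψ α hα]⟩

theorem Dfn.and (hR : Dfn R) (hR' : Dfn R') : Dfn fun α v => R α v ∧ R' α v := by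
  obtain ⟨φ, hφ⟩ := hR
  obtain ⟨ψ, hψ⟩ := hR'
  exact ⟨φ ⊓ ψ, fun α hα v => by rw [Formula.realize_inf, hφ α hα, hψ α hα]⟩

theorem Dfn.or (hR : Dfn R) (hR' : Dfn R') : Dfn fun α v => R α v ∨ R' α v := by
  obtain ⟨φ, hφ⟩ := hR
  obtain ⟨ψ, hψ⟩ := hR'
  exact ⟨φ ⊔ ψ, fun α hα v => by rw [Formula.realize_sup, hφ α hα, hψ α hα]⟩

theorem Dfn.iff (hR : Dfn R) (hR' : Dfn R') : Dfn fun α v => (R α v ↔ R' α v) :=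
  ((hR.imp hR').and (hR'.imp hR)).congr fun _ _ _ _ => iff_iff_implies_and_implies

theorem Dfn.all {R : Ordinal.{0} → (ι → ZFSet.{0}) → ZFSet.{0} → Prop}
    (hR : Dfn fun α (w : ι ⊕ Unit → ZFSet.{0}) => R α (fun i => w (Sum.inl i)) (w (Sum.inr ()))) :
    Dfn fun α v => ∀ x ∈ Vset α, R α v x := by
  obtain ⟨φ, hφ⟩ := hR
  refine ⟨φ.iAlls Unit, fun α hα v => ?_⟩
  rw [Formula.realize_iAlls]
  refine ⟨fun H x hx => ?_, fun H i => ?_⟩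
  · exact (hφ α hα _).1 (H fun _ => ⟨x, hx⟩)
  · exact (hφ α hα _).2 (H (i ()).1 (i ()).2)

theorem Dfn.ex {R : Ordinal.{0} → (ι → ZFSet.{0}) → ZFSet.{0} → Prop}
    (hR : Dfn fun α (w : ι ⊕ Unit → ZFSet.{0}) => R α (fun i => w (Sum.inl i)) (w (Sum.inr ()))) :
    Dfn fun α v => ∃ x ∈ Vset α, R α v x :=
  (Dfn.all (R := fun α v x => ¬ R α v x) hR.not).not.congr fun _ _ _ _ => by
    push Not
    rfl

/-- Bounded universal quantification. -/
theorem Dfn.ball {R : Ordinal.{0} → (ι → ZFSet.{0}) → ZFSet.{0} → Prop} (hf : IsVar f)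
    (hR : Dfn fun α (w : ι ⊕ Unit → ZFSet.{0}) => R α (fun i => w (Sum.inl i)) (w (Sum.inr ()))) :
    Dfn fun α v => ∀ x ∈ f v, R α v x := by
  refine (Dfn.all (R := fun α v x => x ∈ f v → R α v x)
    ((dfn_mem isVar_new hf.weaken).imp hR)).congr fun α hα v hv => ?_
  obtain ⟨i, hi⟩ := hf
  simp only [hi]
  exact ⟨fun H x _ => H x, fun H x hx => H x ((ZFSet.rank_lt_of_mem hx).trans (hv i)) hx⟩

/-- Bounded existential quantification. -/
theorem Dfn.bex {R : Ordinal.{0} → (ι → ZFSet.{0}) → ZFSet.{0} → Prop} (hf : IsVar f)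
    (hR : Dfn fun α (w : ι ⊕ Unit → ZFSet.{0}) => R α (fun i => w (Sum.inl i)) (w (Sum.inr ()))) :
    Dfn fun α v => ∃ x ∈ f v, R α v x :=
  (Dfn.ball (R := fun α v x => ¬ R α v x) hf hR.not).not.congr fun _ _ _ _ => by
    push Not
    rfl

theorem dfn_subset (hf : IsVar f) (hg : IsVar g) : Dfn fun _ v => f v ⊆ g v :=
  (Dfn.ball (R := fun _ v x => x ∈ g v) hf (dfn_mem isVar_new hg.weaken)).congr
    fun _ _ _ _ => Iff.rfl

theorem dfn_eq_insert_pair (hf : IsVar f) (hg : IsVar g) (hh : IsVar h) :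
    Dfn fun _ v => f v = {g v, h v} := by
  refine (((dfn_mem hg hf).and (dfn_mem hh hf)).and
    (Dfn.ball (R := fun _ v z => z = g v ∨ z = h v) hf ((dfn_eq isVar_new hg.weaken).or
      (dfn_eq isVar_new hh.weaken)))).congr fun α hα v hv => ?_
  refine ⟨fun H => by simp [H], fun ⟨⟨h₁, h₂⟩, H⟩ => ?_⟩
  ext z
  rw [ZFSet.mem_pair]
  exact ⟨H z, by rintro (rfl | rfl) <;> assumption⟩

theorem dfn_eq_pair (hf : IsVar f) (hg : IsVar g) (hh : IsVar h) :
    Dfn fun _ v => f v = (g v).pair (h v) := by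
  refine (Dfn.bex (R := fun _ v a => a = {g v, g v} ∧
    ∃ b ∈ f v, b = {g v, h v} ∧ f v = {a, b}) hf
    ((dfn_eq_insert_pair isVar_new hg.weaken hg.weaken).and
      (Dfn.bex (R := fun _ w b => b = {g fun i => w (Sum.inl i), h fun i => w (Sum.inl i)} ∧
        (f fun i => w (Sum.inl i)) = {w (Sum.inr ()), b}) hf.weaken
        ((dfn_eq_insert_pair isVar_new hg.weaken.weaken hh.weaken.weaken).and
          (dfn_eq_insert_pair hf.weaken.weaken isVar_new.weaken isVar_new))))).congr
    fun α hα v hv => ?_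
  constructor
  · intro H
    exact ⟨{g v}, by simp [H, ZFSet.pair], by simp, {g v, h v}, by simp [H, ZFSet.pair], rfl, H⟩
  · rintro ⟨a, -, rfl, b, -, rfl, H⟩
    rw [H, ZFSet.pair, ZFSet.pair_eq_singleton]

theorem dfn_pair_mem (hf : IsVar f) (hg : IsVar g) (hh : IsVar h) :
    Dfn fun _ v => (f v).pair (g v) ∈ h v :=
  (Dfn.bex (R := fun _ v z => z = (f v).pair (g v)) hh
    (dfn_eq_pair isVar_new hf.weaken hg.weaken)).congr fun _ _ _ _ => by simp

end Dfn

/-- The transitions of the evaluation game on environments in `W`: stay, assign a value to a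
variable, test a membership, test an equality. -/
def Step (q : Fin 5 → ZFSet.{0}) (W k s s' : ZFSet.{0}) : Prop :=
  (k = q 0 ∧ s' = s) ∨
  (∃ i ∈ W, ∃ x ∈ W, ∃ p ∈ W, k = (q 1).pair i ∧ p = i.pair x ∧ s' = insert p s) ∨
  (∃ i ∈ W, ∃ j ∈ W, ∃ l ∈ W, ∃ x ∈ W, ∃ y ∈ W, l = i.pair j ∧ s' = s ∧ i.pair x ∈ s ∧
    j.pair y ∈ s ∧ ((k = (q 2).pair l ∧ x ∈ y) ∨ (k = (q 3).pair l ∧ x = y)))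

/-- `S` is a satisfaction relation for the environments in `W` and the codes in `q 4`. -/
def IsSat (q : Fin 5 → ZFSet.{0}) (W S : ZFSet.{0}) : Prop :=
  ∀ s ∈ W, ∀ e ∈ q 4, (s.pair e ∈ S ↔
    ∀ k ∈ q 4, ∀ e' ∈ q 4, k.pair e' ∈ e → ∃ s' ∈ W, Step q W k s s' ∧ ¬ s'.pair e' ∈ S)

/-- `τ` contains exactly the codes satisfied by `s` in `W`, as seen by `V_α`. -/
def Typ (α : Ordinal.{0}) (q : Fin 5 → ZFSet.{0}) (W s τ : ZFSet.{0}) : Prop :=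
  ∃ S ∈ Vset α, IsSat q W S ∧ ∀ e ∈ q 4, (e ∈ τ ↔ s.pair e ∈ S)

/-- The hierarchy of `Σₙ`-correct transitive sets, as defined in `V_α`. -/
def Correct : ℕ → Ordinal.{0} → (Fin 5 → ZFSet.{0}) → ZFSet.{0} → Prop
  | 0, _, q, W => q 0 ∈ W ∧ (∀ x ∈ W, x ⊆ W) ∧ ∀ x ∈ W, ∀ y ∈ W, ∃ z ∈ W, z = insert x y
  | n + 1, α, q, W => Correct n α q W ∧ ∀ s ∈ W, ∀ W' ∈ Vset α, Correct n α q W' → s ∈ W' →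
      ∃ W'' ∈ Vset α, Correct n α q W'' ∧ s ∈ W'' ∧ W'' ⊆ W ∧
        ∃ τ ∈ Vset α, τ ⊆ q 4 ∧ Typ α q W' s τ ∧ Typ α q W'' s τ

section Definability

variable {ι : Type} {f g h : (ι → ZFSet.{0}) → ZFSet.{0}} {q : (ι → ZFSet.{0}) → Fin 5 → ZFSet.{0}}

theorem IsVar.exists_eq (hf : IsVar f) : ∃ i, f = fun v => v i := by
  obtain ⟨i, hi⟩ := hf
  exact ⟨i, funext hi⟩

theorem exists_eq_of_isVar (hq : ∀ j, IsVar fun v => q v j) :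
    ∃ i : Fin 5 → ι, q = fun v j => v (i j) := by
  choose i hi using hq
  exact ⟨i, funext fun v => funext fun j => hi j v⟩

theorem dfn_eq_insert (hf : IsVar f) (hg : IsVar g) (hh : IsVar h) :
    Dfn fun _ v => f v = insert (g v) (h v) := by
  refine (((dfn_mem hg hf).and (dfn_subset hh hf)).and
    (Dfn.ball (R := fun _ v z => z = g v ∨ z ∈ h v) hf ((dfn_eq isVar_new hg.weaken).or
      (dfn_mem isVar_new hh.weaken)))).congr fun α hα v hv => ?_
  refine ⟨fun H => ?_, fun ⟨⟨h₁, h₂⟩, H⟩ => ?_⟩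
  · simp [H]
    intro z hz
    simp [hz]
  ext z
  rw [ZFSet.mem_insert_iff]
  exact ⟨H z, by rintro (rfl | hz); exacts [h₁, h₂ hz]⟩

theorem dfn_step {W k s s' : (ι → ZFSet.{0}) → ZFSet.{0}} (hq : ∀ j, IsVar fun v => q v j)
    (hW : IsVar W) (hk : IsVar k) (hs : IsVar s) (hs' : IsVar s') :
    Dfn fun _ v => Step (q v) (W v) (k v) (s v) (s' v) := by
  obtain ⟨i, rfl⟩ := exists_eq_of_isVar hq
  obtain ⟨W, rfl⟩ := hW.exists_eq
  obtain ⟨k, rfl⟩ := hk.exists_eq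
  obtain ⟨s, rfl⟩ := hs.exists_eq
  obtain ⟨s', rfl⟩ := hs'.exists_eq
  unfold Step
  repeat' first
    | exact isVar_proj _
    | apply dfn_eq_pair | apply dfn_eq_insert | apply dfn_eq | apply dfn_pair_mem | apply dfn_mem
    | apply Dfn.or | apply Dfn.and | apply Dfn.bex

theorem dfn_isSat {W S : (ι → ZFSet.{0}) → ZFSet.{0}} (hq : ∀ j, IsVar fun v => q v j)
    (hW : IsVar W) (hS : IsVar S) : Dfn fun _ v => IsSat (q v) (W v) (S v) := by
  obtain ⟨i, rfl⟩ := exists_eq_of_isVar hq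
  obtain ⟨W, rfl⟩ := hW.exists_eq
  obtain ⟨S, rfl⟩ := hS.exists_eq
  unfold IsSat
  repeat' first
    | exact isVar_proj _
    | apply dfn_pair_mem | apply Dfn.iff | apply Dfn.bex | apply Dfn.ball | apply Dfn.not
    | apply dfn_step fun _ => isVar_proj _ | apply Dfn.and | apply Dfn.imp

theorem dfn_typ {W s τ : (ι → ZFSet.{0}) → ZFSet.{0}} (hq : ∀ j, IsVar fun v => q v j)
    (hW : IsVar W) (hs : IsVar s) (hτ : IsVar τ) :
    Dfn fun α v => Typ α (q v) (W v) (s v) (τ v) := by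
  obtain ⟨i, rfl⟩ := exists_eq_of_isVar hq
  obtain ⟨W, rfl⟩ := hW.exists_eq
  obtain ⟨s, rfl⟩ := hs.exists_eq
  obtain ⟨τ, rfl⟩ := hτ.exists_eq
  unfold Typ
  repeat' first
    | exact isVar_proj _
    | apply dfn_pair_mem | apply dfn_mem | apply dfn_isSat fun _ => isVar_proj _
    | apply Dfn.iff | apply Dfn.ex | apply Dfn.ball | apply Dfn.and

theorem dfn_correct (n : ℕ) {ι : Type} {q : (ι → ZFSet.{0}) → Fin 5 → ZFSet.{0}}
    {W : (ι → ZFSet.{0}) → ZFSet.{0}} (hq : ∀ j, IsVar fun v => q v j)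
    (hW : IsVar W) : Dfn fun α v => Correct n α (q v) (W v) := by
  obtain ⟨i, rfl⟩ := exists_eq_of_isVar hq
  obtain ⟨W, rfl⟩ := hW.exists_eq
  induction n generalizing ι with
  | zero =>
    unfold Correct
    repeat' first
      | exact isVar_proj _
      | apply dfn_mem | apply dfn_eq_insert | apply dfn_subset | apply Dfn.bex | apply Dfn.ball
      | apply Dfn.and
  | succ n ih =>
    unfold Correct
    repeat' first
      | exact isVar_proj _
      | exact ih _ (fun _ => isVar_proj _) _ (isVar_proj _)
      | apply dfn_mem | apply dfn_subset | apply dfn_typ fun _ => isVar_proj _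
      | apply Dfn.ex | apply Dfn.all | apply Dfn.ball | apply Dfn.and | apply Dfn.imp

end Definability

theorem rank_lt_rank_pair_right (x y : ZFSet.{0}) : y.rank < (x.pair y).rank := by
  rw [rank_ordered_pair]
  exact (le_max_right _ _).trans_lt ((Order.lt_succ _).trans (Order.lt_succ _))

/-- The environment `s` satisfies the code `e` in `W`. A code is a set of pairs `(k, e')`, each
asserting that some transition labelled `k` leads to an environment not satisfying `e'`. -/
def Holds (q : Fin 5 → ZFSet.{0}) (W e s : ZFSet.{0}) : Prop :=
  ∀ k e' : ZFSet.{0}, (_ : k.pair e' ∈ e) → ∃ s' ∈ W, Step q W k s s' ∧ ¬ Holds q W e' s'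
termination_by e.rank
decreasing_by
  rename_i he
  exact (rank_lt_rank_pair_right _ _).trans (ZFSet.rank_lt_of_mem he)

theorem holds_iff {q : Fin 5 → ZFSet.{0}} {W e s : ZFSet.{0}} :
    Holds q W e s ↔
      ∀ k e' : ZFSet.{0}, k.pair e' ∈ e → ∃ s' ∈ W, Step q W k s s' ∧ ¬ Holds q W e' s' := by
  rw [Holds]

theorem holds_singleton {q : Fin 5 → ZFSet.{0}} {W k e s : ZFSet.{0}} :
    Holds q W {k.pair e} s ↔ ∃ s' ∈ W, Step q W k s s' ∧ ¬ Holds q W e s' := by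
  rw [holds_iff]
  simp only [ZFSet.mem_singleton, ZFSet.pair_inj]
  exact ⟨fun H => H _ _ ⟨rfl, rfl⟩, by rintro H _ _ ⟨rfl, rfl⟩; exact H⟩

/-- The set `V_ω` of codes is transitive, so a satisfaction relation computes `Holds`. -/
theorem IsSat.pair_mem_iff {q : Fin 5 → ZFSet.{0}} {W S : ZFSet.{0}} (h : IsSat q W S)
    (hq : TransClass {x | x ∈ q 4}) {e : ZFSet.{0}} (he : e ∈ q 4) {s : ZFSet.{0}} (hs : s ∈ W) :
    s.pair e ∈ S ↔ Holds q W e s := by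
  induction hρ : e.rank using WellFoundedLT.induction generalizing e s with
  | _ ρ ih =>
    subst hρ
    have key : ∀ k e' : ZFSet.{0}, k.pair e' ∈ e → k ∈ q 4 ∧ e' ∈ q 4 ∧
        ∀ s' ∈ W, (s'.pair e' ∈ S ↔ Holds q W e' s') := by
      intro k e' hk
      have hk' : k.pair e' ∈ {x | x ∈ q 4} := hq _ he _ hk
      have he' := hq.right_mem_of_pair_mem hk'
      exact ⟨hq.left_mem_of_pair_mem hk', he', fun s' hs' =>
        ih _ ((rank_lt_rank_pair_right _ _).trans (ZFSet.rank_lt_of_mem hk)) he' hs' rfl⟩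
    rw [h s hs e he, holds_iff]
    constructor
    · intro H k e' hk
      obtain ⟨h₁, h₂, h₃⟩ := key k e' hk
      obtain ⟨s', hs', h₄, h₅⟩ := H k h₁ e' h₂ hk
      exact ⟨s', hs', h₄, fun h₆ => h₅ ((h₃ s' hs').2 h₆)⟩
    · intro H k _ e' _ hk
      obtain ⟨h₁, h₂, h₃⟩ := key k e' hk
      obtain ⟨s', hs', h₄, h₅⟩ := H k e' hk
      exact ⟨s', hs', h₄, fun h₆ => h₅ ((h₃ s' hs').1 h₆)⟩

theorem exists_isSat {q : Fin 5 → ZFSet.{0}} (hq : TransClass {x | x ∈ q 4}) {α : Ordinal.{0}}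
    (hα : Order.IsSuccLimit α) (hqα : (q 4).rank < α) {W : ZFSet.{0}} (hW : W.rank < α) :
    ∃ S ∈ Vset α, IsSat q W S := by
  have hmem : ∀ s ∈ W, ∀ e ∈ q 4,
      (s.pair e ∈ ZFSet.pairSep (fun s e => Holds q W e s) W (q 4) ↔ Holds q W e s) := by
    intro s hs e he
    rw [ZFSet.mem_pairSep]
    constructor
    · rintro ⟨a, _, b, _, hab, H⟩
      obtain ⟨rfl, rfl⟩ := ZFSet.pair_inj.1 hab
      exact H
    · exact fun H => ⟨s, hs, e, he, rfl, H⟩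
  refine ⟨ZFSet.pairSep (fun s e => Holds q W e s) W (q 4), ?_, ?_⟩
  · refine (?_ : _ ≤ Order.succ (Order.succ (max W.rank (q 4).rank))).trans_lt
      (hα.succ_lt (hα.succ_lt (max_lt hW hqα)))
    rw [ZFSet.rank_le_iff]
    intro z hz
    obtain ⟨a, ha, b, hb, rfl, -⟩ := ZFSet.mem_pairSep.1 hz
    rw [rank_ordered_pair]
    exact Order.succ_lt_succ (Order.succ_lt_succ
      (max_lt_max (ZFSet.rank_lt_of_mem ha) (ZFSet.rank_lt_of_mem hb)))
  · intro s hs e he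
    rw [hmem s hs e he, holds_iff]
    constructor
    · intro H k hk e' he' hke
      obtain ⟨s', hs', h₁, h₂⟩ := H k e' hke
      exact ⟨s', hs', h₁, fun h₃ => h₂ ((hmem s' hs' e' he').1 h₃)⟩
    · intro H k e' hke
      have hk' : k.pair e' ∈ {x | x ∈ q 4} := hq _ he _ hke
      have he' : e' ∈ q 4 := hq.right_mem_of_pair_mem hk'
      obtain ⟨s', hs', h₁, h₂⟩ := H k (hq.left_mem_of_pair_mem hk') e' he' hke
      exact ⟨s', hs', h₁, fun h₃ => h₂ ((hmem s' hs' e' he').2 h₃)⟩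

theorem typ_iff {q : Fin 5 → ZFSet.{0}} (hq : TransClass {x | x ∈ q 4}) {α : Ordinal.{0}}
    (hα : Order.IsSuccLimit α) (hqα : (q 4).rank < α) {W s τ : ZFSet.{0}} (hW : W.rank < α)
    (hs : s ∈ W) : Typ α q W s τ ↔ ∀ e ∈ q 4, (e ∈ τ ↔ Holds q W e s) := by
  constructor
  · rintro ⟨S, -, hS, H⟩ e he
    rw [H e he, hS.pair_mem_iff hq he hs]
  · intro H
    obtain ⟨S, hSα, hS⟩ := exists_isSat hq hα hqα hW
    exact ⟨S, hSα, hS, fun e he => by rw [H e he, hS.pair_mem_iff hq he hs]⟩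

/-- Codes for the variables and for the labels of transitions. -/
def name : ℕ → ZFSet.{0}
  | 0 => ∅
  | n + 1 => {name n}

theorem name_injective : Function.Injective name := by
  intro m n h
  induction m generalizing n with
  | zero =>
    cases n with
    | zero => rfl
    | succ n =>
      have : name n ∈ name 0 := h ▸ ZFSet.mem_singleton.2 rfl
      exact absurd this (ZFSet.notMem_empty _)
  | succ m ih =>
    cases n with
    | zero =>
      have : name m ∈ name 0 := h ▸ ZFSet.mem_singleton.2 rfl
      exact absurd this (ZFSet.notMem_empty _)
    | succ n => exact congrArg _ (ih (ZFSet.singleton_injective h))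

/-- The parameters: four labels and the set `V_ω` of codes. -/
noncomputable def param : Fin 5 → ZFSet.{0} :=
  ![name 0, name 1, name 2, name 3, ZFSet.vonNeumann Ordinal.omega0]

theorem mem_param_four {x : ZFSet.{0}} : x ∈ param 4 ↔ x.rank < Ordinal.omega0 :=
  ZFSet.mem_vonNeumann

theorem transClass_param_four : TransClass {x | x ∈ param 4} := fun _ hx _ hy =>
  mem_param_four.2 ((ZFSet.rank_lt_of_mem hy).trans (mem_param_four.1 hx))

theorem rank_name_lt (n : ℕ) : (name n).rank < Ordinal.omega0 := by
  induction n with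
  | zero => simp [name]
  | succ n ih =>
    rw [name, ZFSet.rank_singleton]
    exact Ordinal.isSuccLimit_omega0.succ_lt ih

section Base

variable {W : ZFSet.{0}} {α : Ordinal.{0}}

theorem Correct.zero {n : ℕ} {q : Fin 5 → ZFSet.{0}} (h : Correct n α q W) : Correct 0 α q W := by
  induction n with
  | zero => exact h
  | succ n ih => exact ih h.1

theorem Correct.transClass {n : ℕ} {q : Fin 5 → ZFSet.{0}} (h : Correct n α q W) :
    TransClass {x | x ∈ W} := fun x hx _ hy => h.zero.2.1 x hx hy

theorem Correct.insert_mem (h : Correct 0 α param W) {x y : ZFSet.{0}} (hx : x ∈ W) (hy : y ∈ W) :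
    insert x y ∈ W := by
  obtain ⟨z, hz, rfl⟩ := h.2.2 x hx y hy
  exact hz

theorem Correct.empty_mem (h : Correct 0 α param W) : ∅ ∈ W := h.1

theorem Correct.singleton_mem (h : Correct 0 α param W) {x : ZFSet.{0}} (hx : x ∈ W) :
    {x} ∈ W := by
  rw [← insert_empty_eq]
  exact h.insert_mem hx h.empty_mem

theorem Correct.pair_mem (h : Correct 0 α param W) {x y : ZFSet.{0}} (hx : x ∈ W) (hy : y ∈ W) :
    x.pair y ∈ W :=
  h.insert_mem (h.singleton_mem hx) (h.singleton_mem (h.insert_mem hx (h.singleton_mem hy)))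

theorem Correct.name_mem (h : Correct 0 α param W) (n : ℕ) : name n ∈ W := by
  induction n with
  | zero => exact h.empty_mem
  | succ n ih => exact h.singleton_mem ih

theorem empty_ne_pair (x y : ZFSet.{0}) : ∅ ≠ x.pair y := by
  intro h
  have : ({x} : ZFSet.{0}) ∈ x.pair y := by simp [ZFSet.pair]
  exact ZFSet.notMem_empty _ (h ▸ this)

theorem step_stay {s s' : ZFSet.{0}} : Step param W (name 0) s s' ↔ s' = s := by
  constructor
  · rintro (⟨-, h⟩ | ⟨i, -, x, -, p, -, h, -⟩ |
      ⟨i, -, j, -, l, -, x, -, y, -, -, h, -⟩)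
    · exact h
    · exact absurd h (empty_ne_pair _ _)
    · exact h
  · exact fun h => Or.inl ⟨rfl, h⟩

theorem step_assign (hW : Correct 0 α param W) {i s s' : ZFSet.{0}} (hi : i ∈ W) :
    Step param W ((name 1).pair i) s s' ↔ ∃ x ∈ W, s' = insert (i.pair x) s := by
  constructor
  · rintro (⟨h, -⟩ | ⟨i, -, x, hx, p, -, h, rfl, rfl⟩ |
      ⟨i, -, j, -, l, -, x, -, y, -, -, -, -, -, ⟨h, -⟩ | ⟨h, -⟩⟩)
    · exact absurd h.symm (empty_ne_pair _ _)
    · obtain ⟨-, rfl⟩ := ZFSet.pair_inj.1 h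
      exact ⟨x, hx, rfl⟩
    · exact absurd (name_injective (a₂ := 2) (ZFSet.pair_inj.1 h).1) (by decide)
    · exact absurd (name_injective (a₂ := 3) (ZFSet.pair_inj.1 h).1) (by decide)
  · rintro ⟨x, hx, rfl⟩
    exact Or.inr (Or.inl ⟨i, hi, x, hx, _, hW.pair_mem hi hx, rfl, rfl, rfl⟩)

theorem step_mem (hW : Correct 0 α param W) {i j s s' : ZFSet.{0}} (hs : s ∈ W) :
    Step param W ((name 2).pair (i.pair j)) s s' ↔
      s' = s ∧ ∃ x y, i.pair x ∈ s ∧ j.pair y ∈ s ∧ x ∈ y := by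
  constructor
  · rintro (⟨h, -⟩ | ⟨i, -, x, hx, p, -, h, rfl, rfl⟩ |
      ⟨i, -, j, -, l, -, x, -, y, -, rfl, h₁, h₂, h₃, ⟨h, h₄⟩ | ⟨h, -⟩⟩)
    · exact absurd h.symm (empty_ne_pair _ _)
    · exact absurd (name_injective (a₂ := 1) (ZFSet.pair_inj.1 h).1) (by decide)
    · obtain ⟨rfl, rfl⟩ := ZFSet.pair_inj.1 (ZFSet.pair_inj.1 h).2
      exact ⟨h₁, x, y, h₂, h₃, h₄⟩
    · exact absurd (name_injective (a₂ := 3) (ZFSet.pair_inj.1 h).1) (by decide)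
  · rintro ⟨rfl, x, y, h₁, h₂, h₃⟩
    have h₁' := hW.transClass _ hs _ h₁
    have h₂' := hW.transClass _ hs _ h₂
    have hi := hW.transClass.left_mem_of_pair_mem h₁'
    have hj := hW.transClass.left_mem_of_pair_mem h₂'
    exact Or.inr (Or.inr ⟨i, hi, j, hj, _, hW.pair_mem hi hj,
      x, hW.transClass.right_mem_of_pair_mem h₁', y, hW.transClass.right_mem_of_pair_mem h₂',
      rfl, rfl, h₁, h₂, Or.inl ⟨rfl, h₃⟩⟩)

theorem step_eq (hW : Correct 0 α param W) {i j s s' : ZFSet.{0}} (hs : s ∈ W) :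
    Step param W ((name 3).pair (i.pair j)) s s' ↔
      s' = s ∧ ∃ x, i.pair x ∈ s ∧ j.pair x ∈ s := by
  constructor
  · rintro (⟨h, -⟩ | ⟨i, -, x, hx, p, -, h, rfl, rfl⟩ |
      ⟨i, -, j, -, l, -, x, -, y, -, rfl, h₁, h₂, h₃, ⟨h, -⟩ | ⟨h, rfl⟩⟩)
    · exact absurd h.symm (empty_ne_pair _ _)
    · exact absurd (name_injective (a₂ := 1) (ZFSet.pair_inj.1 h).1) (by decide)
    · exact absurd (name_injective (a₂ := 2) (ZFSet.pair_inj.1 h).1) (by decide)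
    · obtain ⟨rfl, rfl⟩ := ZFSet.pair_inj.1 (ZFSet.pair_inj.1 h).2
      exact ⟨h₁, x, h₂, h₃⟩
  · rintro ⟨rfl, x, h₁, h₂⟩
    have h₁' := hW.transClass _ hs _ h₁
    have h₂' := hW.transClass _ hs _ h₂
    have hi := hW.transClass.left_mem_of_pair_mem h₁'
    have hj := hW.transClass.left_mem_of_pair_mem h₂'
    exact Or.inr (Or.inr ⟨i, hi, j, hj, _, hW.pair_mem hi hj,
      x, hW.transClass.right_mem_of_pair_mem h₁', x, hW.transClass.right_mem_of_pair_mem h₂',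
      rfl, rfl, h₁, h₂, Or.inr ⟨rfl, rfl⟩⟩)

theorem holds_neg {e s : ZFSet.{0}} (hs : s ∈ W) :
    Holds param W {(name 0).pair e} s ↔ ¬ Holds param W e s := by
  rw [holds_singleton]
  simp [step_stay, hs]

theorem holds_empty {q : Fin 5 → ZFSet.{0}} {s : ZFSet.{0}} : Holds q W ∅ s := by
  rw [holds_iff]
  exact fun _ _ h => absurd h (ZFSet.notMem_empty _)

theorem holds_pair {q : Fin 5 → ZFSet.{0}} {a b s : ZFSet.{0}} :
    Holds q W {a, b} s ↔ Holds q W {a} s ∧ Holds q W {b} s := by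
  simp only [holds_iff (e := {a, b}), holds_iff (e := {a}), holds_iff (e := {b}), ZFSet.mem_pair,
    ZFSet.mem_singleton, or_imp, forall_and]

/-- The environment assigning the values `v` and `xs` to the variables. -/
noncomputable def env {n : ℕ} (v : Fin 1 → ZFSet.{0}) (xs : Fin n → ZFSet.{0}) : ZFSet.{0} :=
  ZFSet.range fun t : Fin 1 ⊕ Fin n =>
    (name (Sum.elim (fun _ => 0) (fun i => i.1 + 1) t)).pair (Sum.elim v xs t)

theorem Correct.mem_of_finite (hW : Correct 0 α param W) (s : Finset ZFSet.{0}) :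
    (∀ x ∈ s, x ∈ W) → ∃ z ∈ W, ∀ x, x ∈ z ↔ x ∈ s := by
  classical
  induction s using Finset.induction with
  | empty => exact fun _ => ⟨∅, hW.empty_mem, by simp⟩
  | insert a s ha ih =>
    intro h
    obtain ⟨z, hz, H⟩ := ih fun x hx => h x (Finset.mem_insert_of_mem hx)
    exact ⟨insert a z, hW.insert_mem (h a (Finset.mem_insert_self _ _)) hz, by simp [H]⟩

variable {n : ℕ} {v : Fin 1 → ZFSet.{0}} {xs : Fin n → ZFSet.{0}}

theorem env_mem (hW : Correct 0 α param W) (hv : ∀ i, v i ∈ W) (hxs : ∀ i, xs i ∈ W) :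
    env v xs ∈ W := by
  classical
  obtain ⟨z, hz, H⟩ := hW.mem_of_finite (Finset.univ.image fun t : Fin 1 ⊕ Fin n =>
    (name (Sum.elim (fun _ => 0) (fun i => i.1 + 1) t)).pair (Sum.elim v xs t)) (by
      intro x hx
      obtain ⟨t, -, rfl⟩ := Finset.mem_image.1 hx
      refine hW.pair_mem (hW.name_mem _) ?_
      rcases t with i | i
      exacts [hv i, hxs i])
  convert hz
  ext x
  simp [H, env]

theorem pair_mem_env {t : Fin 1 ⊕ Fin n} {x : ZFSet.{0}} :
    (name (Sum.elim (fun _ => 0) (fun i => i.1 + 1) t)).pair x ∈ env v xs ↔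
      x = Sum.elim v xs t := by
  rw [env, ZFSet.mem_range]
  constructor
  · rintro ⟨t', h⟩
    obtain ⟨h₁, rfl⟩ := ZFSet.pair_inj.1 h
    have := name_injective h₁
    congr 1
    rcases t with i | i <;> rcases t' with j | j
    · rw [Subsingleton.elim i j]
    · simp at this
    · simp at this
    · simpa [Fin.ext_iff] using this
  · rintro rfl
    exact ⟨t, rfl⟩

theorem env_snoc {x : ZFSet.{0}} :
    env v (Fin.snoc xs x : Fin (n + 1) → ZFSet.{0}) =
      insert ((name (n + 1)).pair x) (env v xs) := by
  ext z
  simp only [env, ZFSet.mem_insert_iff, ZFSet.mem_range, Sum.exists, Sum.elim_inl, Sum.elim_inr,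
    Fin.exists_fin_succ', Fin.snoc_castSucc, Fin.snoc_last, Fin.val_castSucc, Fin.val_last]
  tauto

end Base

theorem exists_code {n : ℕ} (φ : LSet.BoundedFormula (Fin 1) n) :
    ∃ e ∈ param 4, ∀ (W : ZFSet.{0}) (α : Ordinal.{0}), Correct 0 α param W →
      ∀ (v : Fin 1 → ZFSet.{0}) (xs : Fin n → ZFSet.{0}), (∀ i, v i ∈ W) → (∀ i, xs i ∈ W) →
        (Holds param W e (env v xs) ↔ Tr {x | x ∈ W} φ v xs) := by
  have hω := Ordinal.isSuccLimit_omega0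
  have hpair : ∀ {k e : ZFSet.{0}}, k.rank < Ordinal.omega0 → e ∈ param 4 →
      {k.pair e} ∈ param 4 := by
    intro k e hk he
    rw [mem_param_four, ZFSet.rank_singleton]
    exact hω.succ_lt (rank_pair_lt hω hk (mem_param_four.1 he))
  have h0 : (name 0).rank < Ordinal.omega0 := rank_name_lt 0
  have hempty : ∅ ∈ param 4 := mem_param_four.2 h0
  induction φ with
  | falsum =>
    refine ⟨_, hpair h0 hempty, fun W α hW v xs hv hxs => ?_⟩
    rw [holds_neg (env_mem hW hv hxs)]
    exact iff_of_false (not_not.2 holds_empty) id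
  | @equal n t₁ t₂ =>
    rcases t₁ with i | ⟨f, _⟩
    swap
    · exact f.elim
    rcases t₂ with j | ⟨f, _⟩
    swap
    · exact f.elim
    refine ⟨_, hpair (rank_pair_lt hω (rank_name_lt 3) (rank_pair_lt hω
      (rank_name_lt (Sum.elim (fun _ => 0) (fun i => i.1 + 1) i))
      (rank_name_lt (Sum.elim (fun _ => 0) (fun i => i.1 + 1) j)))) (hpair h0 hempty),
      fun W α hW v xs hv hxs => ?_⟩
    have hs := env_mem hW hv hxs
    rw [holds_singleton]
    constructor
    · rintro ⟨s', hs', h, -⟩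
      obtain ⟨-, x, h₁, h₂⟩ := (step_eq hW hs).1 h
      rw [pair_mem_env] at h₁ h₂
      exact h₁.symm.trans h₂
    · intro h
      refine ⟨_, hs, (step_eq hW hs).2 ⟨rfl, Sum.elim v xs i, ?_, ?_⟩, ?_⟩
      · rw [pair_mem_env]
      · rw [pair_mem_env]
        exact h
      · rw [holds_neg hs]
        exact not_not.2 holds_empty
  | @rel n l R ts =>
    cases R
    obtain ⟨i, hi⟩ : ∃ i, ts 0 = Term.var i := by
      rcases ts 0 with i | ⟨f, _⟩
      exacts [⟨i, rfl⟩, f.elim]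
    obtain ⟨j, hj⟩ : ∃ j, ts 1 = Term.var j := by
      rcases ts 1 with i | ⟨f, _⟩
      exacts [⟨i, rfl⟩, f.elim]
    refine ⟨_, hpair (rank_pair_lt hω (rank_name_lt 2) (rank_pair_lt hω
      (rank_name_lt (Sum.elim (fun _ => 0) (fun i => i.1 + 1) i))
      (rank_name_lt (Sum.elim (fun _ => 0) (fun i => i.1 + 1) j)))) (hpair h0 hempty),
      fun W α hW v xs hv hxs => ?_⟩
    have hs := env_mem hW hv hxs
    have hTr : Tr {x | x ∈ W} (BoundedFormula.rel Language.graphRel.adj ts) v xs ↔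
        Sum.elim v xs i ∈ Sum.elim v xs j := by
      change (ts 0).realize _ ∈ (ts 1).realize _ ↔ _
      rw [hi, hj]
      rfl
    rw [holds_singleton, hTr]
    constructor
    · rintro ⟨s', hs', h, -⟩
      obtain ⟨-, x, y, h₁, h₂, h₃⟩ := (step_mem hW hs).1 h
      rw [pair_mem_env] at h₁ h₂
      rwa [← h₁, ← h₂]
    · intro h
      refine ⟨_, hs, (step_mem hW hs).2 ⟨rfl, Sum.elim v xs i, Sum.elim v xs j, ?_, ?_, h⟩, ?_⟩
      · rw [pair_mem_env]
      · rw [pair_mem_env]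
      · rw [holds_neg hs]
        exact not_not.2 holds_empty
  | imp φ ψ ihφ ihψ =>
    obtain ⟨e, he, H⟩ := ihφ
    obtain ⟨e', he', H'⟩ := ihψ
    refine ⟨_, hpair h0 (?_ :
      {(name 0).pair {(name 0).pair e}, (name 0).pair e'} ∈ param 4),
      fun W α hW v xs hv hxs => ?_⟩
    · rw [mem_param_four, ZFSet.rank_pair]
      exact max_lt (hω.succ_lt (rank_pair_lt hω h0 (mem_param_four.1 (hpair h0 he))))
        (hω.succ_lt (rank_pair_lt hω h0 (mem_param_four.1 he')))
    · have hs := env_mem hW hv hxs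
      rw [holds_neg hs, holds_pair, holds_neg hs, holds_neg hs, holds_neg hs,
        H W α hW v xs hv hxs, H' W α hW v xs hv hxs, tr_imp]
      tauto
  | @all n φ ih =>
    obtain ⟨e, he, H⟩ := ih
    refine ⟨_, hpair h0 (hpair (rank_pair_lt hω (rank_name_lt 1) (rank_name_lt (n + 1))) he),
      fun W α hW v xs hv hxs => ?_⟩
    have hs := env_mem hW hv hxs
    rw [holds_neg hs, holds_singleton, tr_all]
    have hmem : ∀ x ∈ W, ∀ i, (Fin.snoc xs x : Fin (n + 1) → ZFSet.{0}) i ∈ W :=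
      fun x hx => snoc_mem (P := {x | x ∈ W}) hxs hx
    push Not
    constructor
    · intro h x hx
      rw [← H W α hW v _ hv (hmem x hx)]
      refine h _ (env_mem hW hv (hmem x hx)) ?_
      rw [step_assign hW (hW.name_mem _)]
      exact ⟨x, hx, env_snoc⟩
    · intro h s' hs' hstep
      obtain ⟨x, hx, rfl⟩ := (step_assign hW (hW.name_mem _)).1 hstep
      rw [← env_snoc, H W α hW v _ hv (hmem x hx)]
      exact h x hx

theorem rank_param_four : (param 4).rank = Ordinal.omega0 := ZFSet.rank_vonNeumann _

theorem rank_param_lt {κ : Ordinal.{0}} (hκ : Ordinal.omega0 < κ) (j : Fin 5) :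
    (param j).rank < κ := by
  fin_cases j
  · exact (rank_name_lt 0).trans hκ
  · exact (rank_name_lt 1).trans hκ
  · exact (rank_name_lt 2).trans hκ
  · exact (rank_name_lt 3).trans hκ
  · exact rank_param_four.trans_lt hκ

theorem rank_insert_lt {α : Ordinal.{0}} (hα : Order.IsSuccLimit α) {x y : ZFSet.{0}}
    (hx : x.rank < α) (hy : y.rank < α) : (insert x y : ZFSet.{0}).rank < α := by
  rw [ZFSet.rank_insert]
  exact max_lt (hα.succ_lt hx) hy

theorem VElem.correct_iff {κ γ : Ordinal.{0}} (h : VElem κ γ) (hκ : Order.IsSuccLimit κ)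
    (hγ : Order.IsSuccLimit γ) (hω : Ordinal.omega0 < κ) (n : ℕ) {W : ZFSet.{0}} (hW : W.rank < κ) :
    Correct n κ param W ↔ Correct n γ param W :=
  Dfn.elementary (R := fun α (v : Fin 5 ⊕ Unit → ZFSet.{0}) =>
      Correct n α (fun j => v (Sum.inl j)) (v (Sum.inr ())))
    (dfn_correct n (fun _ => isVar_proj _) (isVar_proj _)) h hκ hγ
    (v := Sum.elim param fun _ => W) (by
      rintro (j | _)
      exacts [rank_param_lt hω j, hW])

/-- If `V_κ ≺ V_γ` properly, then `V_κ` is correct to all degrees in `V_γ`. -/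
theorem VElem.correct {κ γ : Ordinal.{0}} (h : VElem κ γ) (hκ : Order.IsSuccLimit κ)
    (hγ : Order.IsSuccLimit γ) (hω : Ordinal.omega0 < κ)
    (hκγ : κ < γ) (n : ℕ) : Correct n γ param (ZFSet.vonNeumann κ) := by
  induction n with
  | zero =>
    refine ⟨ZFSet.mem_vonNeumann.2 (rank_param_lt hω 0), fun x hx y hy => ?_,
      fun x hx y hy => ⟨_, ?_, rfl⟩⟩
    · exact ZFSet.mem_vonNeumann.2 ((ZFSet.rank_lt_of_mem hy).trans (ZFSet.mem_vonNeumann.1 hx))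
    · exact ZFSet.mem_vonNeumann.2
        (rank_insert_lt hκ (ZFSet.mem_vonNeumann.1 hx) (ZFSet.mem_vonNeumann.1 hy))
  | succ n ih =>
    refine ⟨ih, fun s hs W' hW' hC hsW' => ?_⟩
    have hs' := ZFSet.mem_vonNeumann.1 hs
    have hqγ : (param 4).rank < γ := (rank_param_lt hω 4).trans hκγ
    set τ : ZFSet.{0} := ZFSet.sep (fun e => Holds param W' e s) (param 4) with hτ
    have hτsub : τ ⊆ param 4 := fun e he => (ZFSet.mem_sep.1 he).1
    have hτrank : τ.rank < κ := (ZFSet.rank_mono hτsub).trans_lt (rank_param_lt hω 4)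
    have htyp : Typ γ param W' s τ := (typ_iff transClass_param_four hγ hqγ hW' hsW').2
      fun e he => by simp [hτ, he]
    have key := Dfn.elementary (R := fun α (v : Fin 5 ⊕ Fin 2 → ZFSet.{0}) =>
        ∃ W ∈ Vset α, Correct n α (fun j => v (Sum.inl j)) W ∧ v (Sum.inr 0) ∈ W ∧
          Typ α (fun j => v (Sum.inl j)) W (v (Sum.inr 0)) (v (Sum.inr 1)))
      (by
        apply Dfn.ex
        exact (dfn_correct n (fun _ => isVar_proj _) (isVar_proj _)).and
          ((dfn_mem (isVar_proj _) (isVar_proj _)).and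
            (dfn_typ (fun _ => isVar_proj _) (isVar_proj _) (isVar_proj _) (isVar_proj _)))) h hκ hγ
      (v := Sum.elim param ![s, τ]) (by
        rintro (j | j)
        · exact rank_param_lt hω j
        · fin_cases j
          exacts [hs', hτrank])
    obtain ⟨W'', hW'', hC'', hsW'', htyp''⟩ := key.2 ⟨W', hW', hC, hsW', htyp⟩
    change s ∈ W'' at hsW''
    have hW''γ : W''.rank < γ := lt_trans hW'' hκγ
    refine ⟨W'', hW''γ, (h.correct_iff hκ hγ hω n hW'').1 hC'', hsW'', fun x hx => ?_, τ,
      hτrank.trans hκγ, hτsub, htyp, ?_⟩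
    · exact ZFSet.mem_vonNeumann.2 ((ZFSet.rank_lt_of_mem hx).trans hW'')
    · rw [typ_iff transClass_param_four hγ hqγ hW''γ hsW'']
      exact (typ_iff transClass_param_four hκ (rank_param_lt hω 4) hW'' hsW'').1 htyp''

theorem VElem.exists_correct {κ γ : Ordinal.{0}} (h : VElem κ γ) (hκ : Order.IsSuccLimit κ)
    (hγ : Order.IsSuccLimit γ) (hω : Ordinal.omega0 < κ)
    (hκγ : κ < γ) (n : ℕ) {x : ZFSet.{0}} (hx : x ∈ Vset κ) :
    ∃ W ∈ Vset κ, Correct n κ param W ∧ x ∈ W := by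
  have key := Dfn.elementary (R := fun α (v : Fin 5 ⊕ Unit → ZFSet.{0}) =>
      ∃ W ∈ Vset α, Correct n α (fun j => v (Sum.inl j)) W ∧ v (Sum.inr ()) ∈ W)
    (by
      apply Dfn.ex
      exact (dfn_correct n (fun _ => isVar_proj _) (isVar_proj _)).and
        (dfn_mem (isVar_proj _) (isVar_proj _))) h hκ hγ
    (v := Sum.elim param fun _ => x) (by
      rintro (j | _)
      exacts [rank_param_lt hω j, hx])
  exact key.2 ⟨ZFSet.vonNeumann κ, (ZFSet.rank_vonNeumann κ).trans_lt hκγ,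
    h.correct hκ hγ hω hκγ n, ZFSet.mem_vonNeumann.2 hx⟩

theorem SigmaUp.trans_down {A : Type} {k : ℕ} {P Q R : Set ZFSet.{0}} (h : SigmaUp A k Q R)
    (h' : SigmaDown A k P R) (hPQ : P ⊆ Q) : SigmaDown A k P Q :=
  fun n φ hφ v xs hv hxs H => h' n φ hφ v xs hv hxs
    (h n φ hφ v xs (fun a => hPQ (hv a)) (fun i => hPQ (hxs i)) H)

/-- Correct sets are elementary for the corresponding level of the Lévy hierarchy. -/
theorem Correct.sigmaUp_and_sigmaDown {κ : Ordinal.{0}} (hκ : Order.IsSuccLimit κ)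
    (hω : Ordinal.omega0 < κ)
    (hub : ∀ n, ∀ x ∈ Vset κ, ∃ W ∈ Vset κ, Correct n κ param W ∧ x ∈ W) {n : ℕ} {W : ZFSet.{0}}
    (hW : W ∈ Vset κ) (h : Correct n κ param W) :
    SigmaUp (Fin 1) n {x | x ∈ W} (Vset κ) ∧ SigmaDown (Fin 1) n {x | x ∈ W} (Vset κ) := by
  have hsub : ∀ {W : ZFSet.{0}}, W ∈ Vset κ → {x | x ∈ W} ⊆ Vset κ :=
    fun hW x hx => transClass_Vset κ _ hW x hx
  induction n generalizing W with
  | zero => exact ⟨sigmaUp_zero (hsub hW) h.transClass, sigmaDown_zero (hsub hW) h.transClass⟩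
  | succ n ih =>
    refine ⟨(ih hW h.1).2.sigmaUp_succ (hsub hW) h.transClass,
      fun m φ hφ v xs hv hxs H => ?_⟩
    obtain ⟨w, hw, hwit⟩ := hφ.exists_witness (Q := Vset κ) (fun x hx y hy => rank_pair_lt hκ hx hy)
      ⟨W, hW⟩ H
    have hs := env_mem h.zero hv hxs
    obtain ⟨W', hW', hC', hpair⟩ := hub n _ (rank_pair_lt hκ hw (hsub hW hs))
    have hsW' : env v xs ∈ W' := hC'.transClass.right_mem_of_pair_mem hpair
    have hwW' : w ∈ W' := hC'.transClass.left_mem_of_pair_mem hpair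
    have hval : ∀ {X : ZFSet.{0}}, TransClass {x | x ∈ X} → env v xs ∈ X →
        (∀ i, v i ∈ X) ∧ ∀ i, xs i ∈ X := fun hX hsX =>
      ⟨fun i => hX.right_mem_of_pair_mem (hX _ hsX _ (pair_mem_env (t := Sum.inl i).2 rfl)),
        fun i => hX.right_mem_of_pair_mem (hX _ hsX _ (pair_mem_env (t := Sum.inr i).2 rfl))⟩
    obtain ⟨hv', hxs'⟩ := hval hC'.transClass hsW'
    have hTr' := hwit _ (hsub hW') hC'.transClass (ih hW' hC').1 hwW' hv' hxs'
    obtain ⟨W'', hW'', hC'', hsW'', hWW, τ, -, -, hτ', hτ''⟩ := h.2 _ hs W' hW' hC' hsW'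
    have hq := transClass_param_four
    rw [typ_iff hq hκ (rank_param_lt hω 4) hW' hsW'] at hτ'
    rw [typ_iff hq hκ (rank_param_lt hω 4) hW'' hsW''] at hτ''
    obtain ⟨hv'', hxs''⟩ := hval hC''.transClass hsW''
    obtain ⟨e, he, hcode⟩ := exists_code φ
    have hTr'' : Tr {x | x ∈ W''} φ v xs := by
      rw [← hcode W'' κ hC''.zero v xs hv'' hxs'', ← hτ'' e he, hτ' e he,
        hcode W' κ hC'.zero v xs hv' hxs']
      exact hTr'
    exact ((ih hW h.1).1.trans_down (ih hW'' hC'').2 hWW).sigmaUp_succ hWW hC''.transClass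
      m φ hφ v xs hv'' hxs'' hTr''

/-- `V_α` sees that the transitive set `W` is closed under subsets and power sets, and that
functions from an element of `W` to `W` are bounded in `W`. -/
def InaccLevel (α : Ordinal.{0}) (W : ZFSet.{0}) : Prop :=
  (∀ x ∈ W, ∀ z ∈ Vset α, z ⊆ x → z ∈ W) ∧
  (∀ x ∈ W, ∃ p ∈ W, ∀ z ∈ Vset α, z ⊆ x → z ∈ p) ∧
  ∀ a ∈ W, ∀ F ∈ Vset α,
    (∀ x ∈ a, ∀ y ∈ W, ∀ y' ∈ W, x.pair y ∈ F → x.pair y' ∈ F → y = y') →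
    ∃ b ∈ W, ∀ x ∈ a, ∀ y ∈ W, x.pair y ∈ F → y ⊆ b

theorem dfn_inaccLevel {ι : Type} {W : (ι → ZFSet.{0}) → ZFSet.{0}} (hW : IsVar W) :
    Dfn fun α v => InaccLevel α (W v) := by
  obtain ⟨W, rfl⟩ := hW.exists_eq
  unfold InaccLevel
  repeat' first
    | exact isVar_proj _
    | apply dfn_eq | apply dfn_pair_mem | apply dfn_mem | apply dfn_subset
    | apply Dfn.ball | apply Dfn.all | apply Dfn.bex | apply Dfn.and | apply Dfn.imp

theorem IsInaccOrd.inaccLevel {κ : Ordinal.{0}} (h : IsInaccOrd κ) (γ : Ordinal.{0}) :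
    InaccLevel γ (ZFSet.vonNeumann κ) := by
  refine ⟨fun x hx z _ hz => ZFSet.mem_vonNeumann_of_subset hz hx, fun x hx =>
    ⟨x.powerset, ?_, fun z _ hz => ZFSet.mem_powerset.2 hz⟩, fun a ha F _ hF => ?_⟩
  · rw [ZFSet.mem_vonNeumann, ZFSet.rank_powerset]
    exact h.isSuccLimit.succ_lt (ZFSet.mem_vonNeumann.1 hx)
  · rw [ZFSet.mem_vonNeumann] at ha
    classical
    let f : ZFSet.{0} → Ordinal.{0} := fun x =>
      if H : ∃ y ∈ ZFSet.vonNeumann κ, x.pair y ∈ F then H.choose.rank else 0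
    have hf : ∀ x, f x < κ := by
      intro x
      by_cases H : ∃ y ∈ ZFSet.vonNeumann κ, x.pair y ∈ F
      · simp only [f, dif_pos H]
        exact ZFSet.mem_vonNeumann.1 H.choose_spec.1
      · simp only [f, dif_neg H]
        exact h.isSuccLimit.bot_lt
    have hsup : ⨆ t : Shrink.{0} a, f ((equivShrink a).symm t).1 < κ := by
      refine Ordinal.iSup_lt_of_lt_cof ?_ fun t => hf _
      refine ((ZFSet.card_mono (ZFSet.subset_vonNeumann_self a)).trans_lt
        (h.card_vonNeumann_lt ha)).trans_le ?_
      have := h.1.le_cof_ord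
      rwa [h.2] at this
    refine ⟨_, ZFSet.vonNeumann_mem_of_lt hsup, fun x hx y hy hxy => ?_⟩
    rw [ZFSet.subset_vonNeumann]
    have H : ∃ y ∈ ZFSet.vonNeumann κ, x.pair y ∈ F := ⟨y, hy, hxy⟩
    have hfx : f x = y.rank := by
      simp only [f, dif_pos H]
      rw [hF x hx _ H.choose_spec.1 y hy H.choose_spec.2 hxy]
    rw [← hfx]
    have := Ordinal.le_iSup (fun t : Shrink.{0} a => f ((equivShrink a).symm t).1)
      (equivShrink a ⟨x, hx⟩)
    simpa using this

section

variable {κ : Ordinal.{0}} {W : ZFSet.{0}}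

theorem InaccLevel.exists_bound (h : InaccLevel κ W) (hκ : Order.IsSuccLimit κ) (hW : W.rank < κ)
    (htr : TransClass {x | x ∈ W}) {a : ZFSet.{0}} (ha : a ∈ W) (f : ZFSet.{0} → ZFSet.{0})
    (hf : ∀ x ∈ a, f x ∈ W) : ∃ b ∈ W, ∀ x ∈ a, f x ⊆ b := by
  have hmem : ∀ x y, x.pair y ∈ ZFSet.pairSep (fun x y => y = f x) W W ↔
      x ∈ W ∧ y ∈ W ∧ y = f x := by
    intro x y
    rw [ZFSet.mem_pairSep]
    constructor
    · rintro ⟨u, hu, w, hw, huw, rfl⟩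
      obtain ⟨rfl, rfl⟩ := ZFSet.pair_inj.1 huw
      exact ⟨hu, hw, rfl⟩
    · exact fun ⟨h₁, h₂, h₃⟩ => ⟨x, h₁, y, h₂, rfl, h₃⟩
  have hrank : (ZFSet.pairSep (fun x y => y = f x) W W).rank < κ := by
    refine (?_ : _ ≤ Order.succ (Order.succ W.rank)).trans_lt (hκ.succ_lt (hκ.succ_lt hW))
    rw [ZFSet.rank_le_iff]
    intro z hz
    obtain ⟨x, hx, y, hy, rfl, -⟩ := ZFSet.mem_pairSep.1 hz
    rw [rank_ordered_pair]
    exact Order.succ_lt_succ (Order.succ_lt_succ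
      (max_lt (ZFSet.rank_lt_of_mem hx) (ZFSet.rank_lt_of_mem hy)))
  obtain ⟨b, hb, H⟩ := h.2.2 a ha _ hrank fun x _ y _ y' _ h₁ h₂ =>
    ((hmem _ _).1 h₁).2.2.trans ((hmem _ _).1 h₂).2.2.symm
  exact ⟨b, hb, fun x hx => H x hx _ (hf x hx)
    ((hmem _ _).2 ⟨htr a ha x hx, hf x hx, rfl⟩)⟩

theorem InaccLevel.vonNeumann_rank_mem (h : InaccLevel κ W) (hκ : Order.IsSuccLimit κ)
    (hW : W.rank < κ) (htr : TransClass {x | x ∈ W}) {x : ZFSet.{0}} (hx : x ∈ W) :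
    ZFSet.vonNeumann x.rank ∈ W := by
  have hsub : ∀ x ∈ W, ∀ z : ZFSet.{0}, z ⊆ x → z ∈ W := fun x hx z hz => h.1 x hx z
    (((ZFSet.rank_mono hz).trans_lt (ZFSet.rank_lt_of_mem hx)).trans hW) hz
  induction x using ZFSet.inductionOn with
  | _ x ih =>
    obtain ⟨b, hb, H⟩ := h.exists_bound hκ hW htr hx
      (fun y => (ZFSet.vonNeumann y.rank).powerset) fun y hy => by
        have hy' := ih y hy (htr x hx y hy)
        obtain ⟨p, hp, hP⟩ := h.2.1 _ hy'
        refine hsub p hp _ fun z hz => hP z ?_ (ZFSet.mem_powerset.1 hz)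
        exact (ZFSet.rank_lt_of_mem (hsub _ hy' z (ZFSet.mem_powerset.1 hz))).trans hW
    refine hsub b hb _ fun z hz => ?_
    obtain ⟨y, hy, hzy⟩ := ZFSet.lt_rank_iff.1 (ZFSet.mem_vonNeumann.1 hz)
    exact H y hy (ZFSet.mem_powerset.2 (ZFSet.subset_vonNeumann.2 hzy))

theorem InaccLevel.eq_vonNeumann (h : InaccLevel κ W) (hκ : Order.IsSuccLimit κ)
    (hW : W.rank < κ) (htr : TransClass {x | x ∈ W}) : W = ZFSet.vonNeumann W.rank := by
  ext x
  refine ⟨fun hx => ZFSet.mem_vonNeumann.2 (ZFSet.rank_lt_of_mem hx), fun hx => ?_⟩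
  have hx' := ZFSet.mem_vonNeumann.1 hx
  obtain ⟨y, hy, hxy⟩ := ZFSet.lt_rank_iff.1 hx'
  exact h.1 _ (h.vonNeumann_rank_mem hκ hW htr hy) x (hx'.trans hW)
    (ZFSet.subset_vonNeumann.2 hxy)

theorem InaccLevel.isSuccLimit_rank (h : InaccLevel κ W) (hW : W.rank < κ)
    (hne : ∃ x, x ∈ W) : Order.IsSuccLimit W.rank := by
  obtain ⟨x, hx⟩ := hne
  refine Ordinal.isSuccLimit_iff.2 ⟨(ZFSet.rank_lt_of_mem hx).ne_bot, ?_⟩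
  rw [Order.isSuccPrelimit_iff_succ_lt]
  intro o ho
  obtain ⟨y, hy, hoy⟩ := ZFSet.lt_rank_iff.1 ho
  obtain ⟨p, hp, hP⟩ := h.2.1 y hy
  refine (Order.succ_le_of_lt ?_).trans_lt (ZFSet.rank_lt_of_mem hp)
  exact hoy.trans_lt (ZFSet.rank_lt_of_mem
    (hP y ((ZFSet.rank_lt_of_mem hy).trans hW) fun _ h => h))

theorem InaccLevel.card_vonNeumann_lt_cof (h : InaccLevel κ W) (hκ : Order.IsSuccLimit κ)
    (hW : W.rank < κ) (htr : TransClass {x | x ∈ W}) {δ : Ordinal.{0}} (hδ : δ < W.rank) :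
    (ZFSet.vonNeumann δ).card < W.rank.cof := by
  by_contra! hle
  have heq := h.eq_vonNeumann hκ hW htr
  obtain ⟨y, hy, -⟩ := ZFSet.lt_rank_iff.1 hδ
  have hlim := h.isSuccLimit_rank hW ⟨y, hy⟩
  rw [← Ordinal.cof_toType] at hle
  obtain ⟨s, hs, hcard⟩ := Order.exists_cof_eq W.rank.ToType
  rw [← hcard, ZFSet.card, Cardinal.le_def] at hle
  obtain ⟨i⟩ := hle
  let j : s → ZFSet.{0} := fun t => ((equivShrink (ZFSet.vonNeumann δ)).symm (i t)).1
  have hj : Function.Injective j := Subtype.val_injective.comp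
    ((equivShrink _).symm.injective.comp i.injective)
  have : Nonempty W.rank.ToType := ⟨Ordinal.ToType.mk ⟨δ, hδ⟩⟩
  have : Nonempty s := hs.nonempty.to_subtype
  let g : ZFSet.{0} → Ordinal.{0} := fun x =>
    (Ordinal.ToType.mk.symm (Function.invFun j x).1 : Set.Iio W.rank).1
  have hg : ∀ x, g x < W.rank := fun x => (Ordinal.ToType.mk.symm (Function.invFun j x).1).2
  have hmem : ∀ o < W.rank, ZFSet.vonNeumann o ∈ W := fun o ho => by
    rw [heq]
    exact ZFSet.vonNeumann_mem_of_lt ho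
  obtain ⟨b, hb, H⟩ := h.exists_bound hκ hW htr (hmem δ hδ)
    (fun x => ZFSet.vonNeumann (g x)) fun x _ => hmem _ (hg x)
  have hbr := hlim.succ_lt (ZFSet.rank_lt_of_mem hb)
  obtain ⟨t, ht, hbt⟩ := hs (Ordinal.ToType.mk ⟨_, hbr⟩)
  have h₁ := ZFSet.rank_mono (H (j ⟨t, ht⟩) ((equivShrink _).symm (i ⟨t, ht⟩)).2)
  rw [ZFSet.rank_vonNeumann] at h₁
  have h₂ : g (j ⟨t, ht⟩) = (Ordinal.ToType.mk.symm t : Set.Iio W.rank).1 := by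
    simp only [g, Function.leftInverse_invFun hj ⟨t, ht⟩]
  rw [h₂] at h₁
  have h₃ : (⟨_, hbr⟩ : Set.Iio W.rank) ≤ Ordinal.ToType.mk.symm t := by
    rwa [OrderIso.le_symm_apply]
  exact lt_irrefl _ ((Order.lt_succ _).trans_le ((Subtype.coe_le_coe.2 h₃).trans h₁))

theorem InaccLevel.isInaccOrd (h : InaccLevel κ W) (hκ : Order.IsSuccLimit κ)
    (hW : W.rank < κ) (htr : TransClass {x | x ∈ W}) (hω : Ordinal.omega0 < W.rank) :
    IsInaccOrd W.rank := by
  obtain ⟨y, hy, -⟩ := ZFSet.lt_rank_iff.1 hω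
  have hlim := h.isSuccLimit_rank hW ⟨y, hy⟩
  have hcof : ∀ {δ}, δ < W.rank → Cardinal.preBeth δ < W.rank.cof := fun hδ => by
    rw [← ZFSet.card_vonNeumann]
    exact h.card_vonNeumann_lt_cof hκ hW htr hδ
  have hle : W.rank ≤ W.rank.cof.ord := le_of_forall_lt fun δ hδ => by
    rw [Cardinal.lt_ord]
    exact δ.card_le_preBeth.trans_lt (hcof hδ)
  have heq : W.rank.cof.ord = W.rank := (Ordinal.ord_cof_le _).antisymm hle
  have hc : W.rank.card = W.rank.cof := by
    conv_lhs => rw [← heq, Cardinal.card_ord]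
  have hord : W.rank.card.ord = W.rank := by rw [hc, heq]
  refine ⟨⟨?_, by rw [hord, hc], fun x hx => ?_⟩, hord⟩
  · rw [← Cardinal.ord_lt_ord, hord, Cardinal.ord_aleph0]
    exact hω
  · have hx' : x.ord < W.rank := by
      rw [← hord]
      exact Cardinal.ord_lt_ord.2 hx
    rw [hc]
    refine lt_of_le_of_lt ?_ (hcof (hlim.succ_lt hx'))
    rw [Order.succ_eq_add_one, Cardinal.preBeth_add_one]
    exact Cardinal.power_le_power_left two_ne_zero (Cardinal.le_preBeth_ord x)

end

theorem IsUplifting.exists_sigmaReflecting {κ : Ordinal.{0}} (h : IsUplifting κ) {θ : Ordinal.{0}}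
    (hθ : θ < κ) : ∃ β, θ < β ∧ β < κ ∧ SigmaReflecting 3 β := by
  obtain ⟨γ, hγ, -, hκγ, hel⟩ := h.2 0
  have hκ := h.1.isSuccLimit
  have hω := h.1.omega0_lt
  have hub : ∀ n, ∀ x ∈ Vset κ, ∃ W ∈ Vset κ, Correct n κ param W ∧ x ∈ W :=
    fun n x hx => hel.exists_correct hκ hγ.isSuccLimit hω hκγ n hx
  have key := Dfn.elementary (R := fun α (v : Fin 5 ⊕ Unit → ZFSet.{0}) =>
      ∃ W ∈ Vset α, Correct 3 α (fun j => v (Sum.inl j)) W ∧ InaccLevel α W ∧ v (Sum.inr ()) ∈ W)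
    (by
      apply Dfn.ex
      exact (dfn_correct 3 (fun _ => isVar_proj _) (isVar_proj _)).and
        ((dfn_inaccLevel (isVar_proj _)).and (dfn_mem (isVar_proj _) (isVar_proj _))))
    hel hκ hγ.isSuccLimit
    (v := Sum.elim param fun _ => ZFSet.vonNeumann (max θ Ordinal.omega0)) (by
      rintro (j | _)
      · exact rank_param_lt hω j
      · exact (ZFSet.rank_vonNeumann _).trans_lt (max_lt hθ hω))
  obtain ⟨W, hW, hC, hI, hθW⟩ := key.2 ⟨ZFSet.vonNeumann κ,
    (ZFSet.rank_vonNeumann κ).trans_lt hκγ, hel.correct hκ hγ.isSuccLimit hω hκγ 3,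
    h.1.inaccLevel γ, ZFSet.vonNeumann_mem_of_lt (max_lt hθ hω)⟩
  have hlt : max θ Ordinal.omega0 < W.rank := by
    have := ZFSet.rank_lt_of_mem hθW
    rwa [Sum.elim_inr, ZFSet.rank_vonNeumann] at this
  refine ⟨W.rank, (le_max_left _ _).trans_lt hlt, hW,
    hI.isInaccOrd hκ hW hC.transClass ((le_max_right _ _).trans_lt hlt), fun φ hφ a ha => ?_⟩
  have hWV : {x | x ∈ W} = Vset W.rank := by
    ext x
    change x ∈ W ↔ _
    rw [hI.eq_vonNeumann hκ hW hC.transClass, ZFSet.mem_vonNeumann, ZFSet.rank_vonNeumann]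
    rfl
  obtain ⟨hup, hdown⟩ := Correct.sigmaUp_and_sigmaDown hκ hω hub hW hC
  rw [hWV] at hup hdown
  have hsub : a ∈ Vset κ := ha.trans hW
  rw [Formula.Realize, Formula.Realize, realize_zfset_iff, realize_vt_iff]
  rw [Subsingleton.elim (fun i => ((default : Fin 0 → Vt W.rank) i).1)
    (@default _ Unique.instInhabited)]
  constructor
  · intro H
    exact hdown 0 φ hφ (fun _ => a) _ (fun _ => ha) (fun i => i.elim0)
      (h.sigmaDown_three 0 φ hφ (fun _ => a) _ (fun _ => hsub) (fun i => i.elim0) H)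
  · intro H
    exact h.sigmaUp_three 0 φ hφ (fun _ => a) _ (fun _ => hsub) (fun i => i.elim0)
      (hup 0 φ hφ (fun _ => a) _ (fun _ => ha) (fun i => i.elim0) H)

/-- Every uplifting cardinal is a limit of Σ₃-reflecting cardinals. -/
theorem uplifting_limit_of_sigma3_reflecting (κ : Ordinal) (h : IsUplifting κ) :
    ∀ θ < κ, ∃ β : Ordinal, θ < β ∧ β < κ ∧ SigmaReflecting 3 β := by
  exact fun θ hθ => h.exists_sigmaReflecting hθ

end Paper
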